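/- arXiv:math/0505075 — 4 statements merged into one kernel-verified Lean document; each statement's English description precedes it below -/
import Mathlib

section
/- Let g be a polynomial in two complex variables. Then there exists a finite set Σ ⊂ ℂ such that the restriction of g, viewed as a map from the subspace {x ∈ ℂ² : g(x) ∉ Σ} of ℂ² to the subspace ℂ ∖ Σ of ℂ, is a locally trivial fibration. -/
open MvPolynomial

/-- A continuous map `p : E → B` is a locally trivial fibration if every point of `B`
has an open neighborhood over which `p` trivializes. -/
def IsLocallyTrivialFibration {E B : Type*} [TopologicalSpace E] [TopologicalSpace B]
    (p : E → B) : Prop :=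
  Continuous p ∧
    ∀ b : B, ∃ U : Set B, IsOpen U ∧ b ∈ U ∧
      ∃ (T : Type) (_ : TopologicalSpace T) (φ : (p ⁻¹' U : Set E) ≃ₜ U × T),
        ∀ e : (p ⁻¹' U : Set E), ((φ e).1 : B) = p (e : E)


/-- finite or cofinite dichotomy (Chevalley). -/
theorem chev_dichotomy {σ : Type} [Finite σ] (F : Finset (MvPolynomial σ ℂ))
    (h ρ : MvPolynomial σ ℂ) :
    let E : Set ℂ := {t | ∃ z : σ → ℂ, (∀ f ∈ F, MvPolynomial.eval z f = 0) ∧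
      MvPolynomial.eval z h ≠ 0 ∧ MvPolynomial.eval z ρ = t}
    E.Finite ∨ Eᶜ.Finite := by
  classical
  intro E
  let φ : Polynomial ℂ →+* MvPolynomial σ ℂ := (Polynomial.aeval ρ).toRingHom
  have hφ : φ.FinitePresentation := by
    have h1 : (algebraMap ℂ (MvPolynomial σ ℂ)).FinitePresentation := by
      rw [RingHom.finitePresentation_algebraMap]; infer_instance
    have h2 : (algebraMap ℂ (Polynomial ℂ)).FiniteType := by
      rw [RingHom.finiteType_algebraMap]; infer_instance
    refine RingHom.FinitePresentation.of_comp_finiteType (algebraMap ℂ (Polynomial ℂ)) (g := φ) ?_ h2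
    convert! h1
    ext x
    simp [φ]
  let V : Set (PrimeSpectrum (MvPolynomial σ ℂ)) :=
    PrimeSpectrum.zeroLocus (F : Set (MvPolynomial σ ℂ)) \ PrimeSpectrum.zeroLocus {h}
  have hV : Topology.IsConstructible V := by
    refine .sdiff ?_ ?_
    · rw [← Topology.isConstructible_compl]
      exact (PrimeSpectrum.isRetrocompact_zeroLocus_compl F.finite_toSet).isConstructible
        (PrimeSpectrum.isClosed_zeroLocus _).isOpen_compl
    · rw [← Topology.isConstructible_compl]
      exact (PrimeSpectrum.isRetrocompact_zeroLocus_compl (Set.finite_singleton _)).isConstructible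
        (PrimeSpectrum.isClosed_zeroLocus _).isOpen_compl
  obtain ⟨D, hD⟩ := PrimeSpectrum.exists_constructibleSetData_iff.mpr
    (PrimeSpectrum.isConstructible_comap_image hφ hV)
  -- membership at closed points
  let pt : ℂ → PrimeSpectrum (Polynomial ℂ) := fun t =>
    ⟨RingHom.ker (Polynomial.evalRingHom t), RingHom.ker_isPrime _⟩
  have key : ∀ t, t ∈ E ↔ pt t ∈ D.toSet := by
    intro t
    rw [hD]
    constructor
    · rintro ⟨z, hz1, hz2, hz3⟩
      refine ⟨⟨RingHom.ker (MvPolynomial.eval z), RingHom.ker_isPrime _⟩, ⟨?_, ?_⟩, ?_⟩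
      · intro f hf
        exact hz1 f hf
      · intro hh
        exact hz2 (hh rfl)
      · ext p
        simp only [PrimeSpectrum.comap_asIdeal, Ideal.mem_comap, RingHom.mem_ker, pt, φ]
        have : MvPolynomial.eval z (Polynomial.aeval ρ p) = p.eval t := by
          rw [← hz3, Polynomial.aeval_def, Polynomial.hom_eval₂]
          have hid : (MvPolynomial.eval z).comp (algebraMap ℂ (MvPolynomial σ ℂ)) =
              RingHom.id ℂ := RingHom.ext fun x => by simp [MvPolynomial.algebraMap_eq]
          rw [hid]
          rfl
        simp [this]
    · rintro ⟨P, ⟨hP1, hP2⟩, hP3⟩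
      have hprime := P.2
      have hvan := MvPolynomial.IsPrime.vanishingIdeal_zeroLocus (K := ℂ) P.asIdeal
      have hh : h ∉ P.asIdeal := by
        intro hh; apply hP2; intro x hx; rw [Set.mem_singleton_iff] at hx; subst hx; exact hh
      rw [← hvan, MvPolynomial.mem_vanishingIdeal_iff] at hh
      push Not at hh
      obtain ⟨z, hz, hz'⟩ := hh
      refine ⟨z, ?_, ?_, ?_⟩
      · intro f hf
        have := hz f (hP1 hf)
        simpa [MvPolynomial.aeval_eq_eval] using this
      · simpa [MvPolynomial.aeval_eq_eval] using hz'
      · have h1 : (Polynomial.X - Polynomial.C t) ∈ (pt t).asIdeal := by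
          simp [pt, RingHom.mem_ker]
        rw [← hP3] at h1
        have h2 := hz _ h1
        simp [φ, MvPolynomial.aeval_eq_eval] at h2
        exact sub_eq_zero.1 h2
  by_cases hex : ∃ C ∈ D, C.f ≠ 0 ∧ ∀ j, C.g j = 0
  · right
    obtain ⟨C, hC, hf, hg⟩ := hex
    refine (C.f.roots.toFinset.finite_toSet).subset ?_
    intro t ht
    rw [Set.mem_compl_iff, key] at ht
    by_contra hcon
    apply ht
    refine Set.mem_biUnion hC ⟨?_, ?_⟩
    · rintro _ ⟨j, rfl⟩
      simp [hg j]
    · intro h3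
      have : C.f ∈ (pt t).asIdeal := h3 rfl
      apply hcon
      simp [hf]
      simpa [pt, RingHom.mem_ker] using this
  · left
    push Not at hex
    have : E ⊆ ⋃ C ∈ D, ⋃ j, (if C.g j = 0 then ∅ else ((C.g j).roots.toFinset : Set ℂ)) := by
      intro t ht
      rw [key] at ht
      obtain ⟨C, hC, h1, h2⟩ := Set.mem_iUnion₂.1 ht
      have hf : C.f ≠ 0 := by
        intro h0; apply h2; intro x hx
        rw [Set.mem_singleton_iff] at hx; subst hx; simp [h0]
      obtain ⟨j, hj⟩ := hex C hC hf
      refine Set.mem_biUnion hC (Set.mem_iUnion.2 ⟨j, ?_⟩)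
      rw [if_neg hj]
      have : C.g j ∈ (pt t).asIdeal := h1 ⟨j, rfl⟩
      simp [hj]
      simpa [pt, RingHom.mem_ker] using this
    refine Set.Finite.subset ?_ this
    refine D.finite_toSet.biUnion fun C hC => Set.finite_iUnion fun j => ?_
    split_ifs
    · exact Set.finite_empty
    · exact Finset.finite_toSet _

/-- the set of parameters with at least `k` distinct solutions is finite or cofinite -/
theorem count_dichotomy (F1 F2 : MvPolynomial (Fin 3) ℂ) (k : ℕ) :
    let E : Set ℂ := {t | ∃ f : Fin k → ℂ × ℂ, Function.Injective f ∧ ∀ i,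
      MvPolynomial.eval ![t, (f i).1, (f i).2] F1 = 0 ∧
      MvPolynomial.eval ![t, (f i).1, (f i).2] F2 = 0}
    E.Finite ∨ Eᶜ.Finite := by
  classical
  intro E
  let σ : Type := Unit ⊕ ((Fin k ⊕ Fin k) ⊕ (Fin k × Fin k))
  let vt : σ := Sum.inl ()
  let vx : Fin k → σ := fun i => Sum.inr (Sum.inl (Sum.inl i))
  let vy : Fin k → σ := fun i => Sum.inr (Sum.inl (Sum.inr i))
  let vl : Fin k × Fin k → σ := fun i => Sum.inr (Sum.inr i)
  let sub : Fin k → MvPolynomial (Fin 3) ℂ → MvPolynomial σ ℂ := fun i P =>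
    MvPolynomial.bind₁ ![MvPolynomial.X vt, MvPolynomial.X (vx i), MvPolynomial.X (vy i)] P
  have hsub : ∀ (z : σ → ℂ) i P, MvPolynomial.eval z (sub i P) =
      MvPolynomial.eval ![z vt, z (vx i), z (vy i)] P := by
    intro z i P
    simp only [sub, MvPolynomial.eval, MvPolynomial.eval₂Hom_bind₁]
    congr 2
    ext j
    fin_cases j <;> simp
  let F : Finset (MvPolynomial σ ℂ) :=
    Finset.univ.image (fun i => sub i F1) ∪ Finset.univ.image (fun i => sub i F2)
  let h : MvPolynomial σ ℂ := ∏ q ∈ (Finset.univ : Finset (Fin k)).offDiag,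
    ((MvPolynomial.X (vx q.1) - MvPolynomial.X (vx q.2)) +
      MvPolynomial.X (vl q) * (MvPolynomial.X (vy q.1) - MvPolynomial.X (vy q.2)))
  have hh : ∀ z : σ → ℂ, MvPolynomial.eval z h ≠ 0 ↔ ∀ i j, i ≠ j →
      (z (vx i) - z (vx j)) + z (vl (i, j)) * (z (vy i) - z (vy j)) ≠ 0 := by
    intro z
    simp only [h, map_prod, Finset.prod_ne_zero_iff]
    simp
  have hF : ∀ z : σ → ℂ, (∀ f ∈ F, MvPolynomial.eval z f = 0) ↔ ∀ i,
      MvPolynomial.eval ![z vt, z (vx i), z (vy i)] F1 = 0 ∧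
      MvPolynomial.eval ![z vt, z (vx i), z (vy i)] F2 = 0 := by
    intro z
    simp only [F, Finset.mem_union, Finset.mem_image, Finset.mem_univ, true_and]
    constructor
    · intro H i
      rw [← hsub, ← hsub]
      exact ⟨H _ (Or.inl ⟨i, rfl⟩), H _ (Or.inr ⟨i, rfl⟩)⟩
    · rintro H f (⟨i, rfl⟩ | ⟨i, rfl⟩)
      · rw [hsub]; exact (H i).1
      · rw [hsub]; exact (H i).2
  have key := chev_dichotomy F h (MvPolynomial.X vt)
  have hE : E = {t | ∃ z : σ → ℂ, (∀ f ∈ F, MvPolynomial.eval z f = 0) ∧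
      MvPolynomial.eval z h ≠ 0 ∧ MvPolynomial.eval z (MvPolynomial.X vt) = t} := by
    apply Set.Subset.antisymm
    · rintro t ⟨f, hf, hz⟩
      let z : σ → ℂ := Sum.elim (fun _ => t) (Sum.elim
        (Sum.elim (fun i => (f i).1) (fun i => (f i).2))
        (fun q => if (f q.1).1 = (f q.2).1 then 1 else 0))
      refine ⟨z, (hF z).2 hz, (hh z).2 ?_, by simp [z, vt]⟩
      intro i j hij
      show ((f i).1 - (f j).1) + (if (f i).1 = (f j).1 then 1 else 0) * ((f i).2 - (f j).2) ≠ 0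
      split_ifs with hx
      · rw [hx, sub_self, zero_add, one_mul, sub_ne_zero]
        intro hy
        exact hij (hf (Prod.ext hx hy))
      · rw [zero_mul, add_zero, sub_ne_zero]
        exact hx
    · rintro t ⟨z, h1, h2, h3⟩
      rw [MvPolynomial.eval_X] at h3
      subst h3
      refine ⟨fun i => (z (vx i), z (vy i)), ?_, (hF z).1 h1⟩
      intro i j hij
      by_contra hne
      have hx := congrArg Prod.fst hij
      have hy := congrArg Prod.snd hij
      simp only at hx hy
      apply (hh z).1 h2 i j hne
      rw [hx, hy]; ring
  rw [hE]
  exact key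

theorem count_constant (F1 F2 : MvPolynomial (Fin 3) ℂ) (P : ℂ → Set (ℂ × ℂ))
    (hP : ∀ t p, p ∈ P t ↔ MvPolynomial.eval ![t, p.1, p.2] F1 = 0 ∧
      MvPolynomial.eval ![t, p.1, p.2] F2 = 0)
    (S₀ : Set ℂ) (hS₀ : S₀.Finite) (N : ℕ)
    (hfin : ∀ t ∉ S₀, (P t).Finite) (hN : ∀ t ∉ S₀, (P t).ncard ≤ N) :
    ∃ S : Set ℂ, S.Finite ∧ ∃ k, ∀ t ∉ S, (P t).ncard = k := by
  classical
  let E : ℕ → Set ℂ := fun k => {t | ∃ f : Fin k → ℂ × ℂ, Function.Injective f ∧ ∀ i,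
      MvPolynomial.eval ![t, (f i).1, (f i).2] F1 = 0 ∧
      MvPolynomial.eval ![t, (f i).1, (f i).2] F2 = 0}
  have hE : ∀ k, (E k).Finite ∨ (E k)ᶜ.Finite := fun k => count_dichotomy F1 F2 k
  have hmem : ∀ t ∉ S₀, ∀ k, t ∈ E k ↔ k ≤ (P t).ncard := by
    intro t ht k
    constructor
    · rintro ⟨f, hf, hz⟩
      have h1 : Set.range f ⊆ P t := by
        rintro _ ⟨i, rfl⟩
        exact (hP t _).2 (hz i)
      have h2 := Set.ncard_le_ncard h1 (hfin t ht)
      rwa [← Set.image_univ, Set.ncard_image_of_injective _ hf, Set.ncard_univ, Nat.card_fin] at h2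
    · intro hk
      obtain ⟨s, hs, hsk⟩ := Set.exists_subset_card_eq hk
      have hsf := (hfin t ht).subset hs
      have e : Fin k ≃ s := by
        have : Finite s := hsf
        refine (Finite.equivFinOfCardEq ?_).symm
        exact hsk
      refine ⟨fun i => (e i).1, Subtype.val_injective.comp e.injective, fun i => ?_⟩
      exact (hP t _).1 (hs (e i).2)
  have hex : ∃ k, (E k).Finite := by
    refine ⟨N + 1, hS₀.subset ?_⟩
    intro t ht
    by_contra hts
    have := (hmem t hts _).1 ht
    have := hN t hts
    omega
  have hspec := Nat.find_spec hex
  rcases hk : Nat.find hex with _ | k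
  · rw [hk] at hspec
    have : E 0 = Set.univ := by
      ext t
      simp only [Set.mem_univ, iff_true]
      exact ⟨Fin.elim0, fun i => Fin.elim0 i, fun i => Fin.elim0 i⟩
    rw [this] at hspec
    exact absurd hspec Set.infinite_univ
  · rw [hk] at hspec
    have hk2 : (E k)ᶜ.Finite := (hE k).resolve_left (Nat.find_min hex (by omega))
    refine ⟨S₀ ∪ E (k + 1) ∪ (E k)ᶜ, (hS₀.union hspec).union hk2, k, ?_⟩
    intro t ht
    have h0 : t ∉ S₀ := fun h => ht (Or.inl (Or.inl h))
    have h1 : t ∉ E (k + 1) := fun h => ht (Or.inl (Or.inr h))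
    have h2 : t ∈ E k := by
      by_contra h
      exact ht (Or.inr h)
    rw [hmem t h0] at h1 h2
    omega

/-- A change of coordinates making a nonconstant polynomial monic (up to a constant) in `y`. -/
theorem exists_monic_form (g : MvPolynomial (Fin 2) ℂ) (hg : ∀ c, g ≠ MvPolynomial.C c) :
    ∃ (N : ℕ) (G : Polynomial (Polynomial ℂ)) (n : ℕ) (a : ℂ), a ≠ 0 ∧ 1 ≤ n ∧
      G.natDegree = n ∧ G.coeff n = Polynomial.C a ∧
      ∀ x y, G.evalEval x y = MvPolynomial.eval ![x + y ^ N, y] g := by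
  classical
  let N := g.totalDegree + 1
  let term : (Fin 2 →₀ ℕ) → Polynomial (Polynomial ℂ) := fun m =>
    Polynomial.C (Polynomial.C (g.coeff m)) *
      ((Polynomial.X ^ N + Polynomial.C Polynomial.X) ^ (m 0) * Polynomial.X ^ (m 1))
  let G : Polynomial (Polynomial ℂ) := ∑ m ∈ g.support, term m
  let wt : (Fin 2 →₀ ℕ) → ℕ := fun m => N * m 0 + m 1
  have hmon : ∀ m : Fin 2 →₀ ℕ, ((Polynomial.X ^ N + Polynomial.C Polynomial.X) ^ (m 0) *
      Polynomial.X ^ (m 1) : Polynomial (Polynomial ℂ)).Monic := by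
    intro m
    exact ((Polynomial.monic_X_pow_add_C _ (by omega)).pow _).mul (Polynomial.monic_X_pow _)
  have hdegm : ∀ m : Fin 2 →₀ ℕ, ((Polynomial.X ^ N + Polynomial.C Polynomial.X) ^ (m 0) *
      Polynomial.X ^ (m 1) : Polynomial (Polynomial ℂ)).natDegree = wt m := by
    intro m
    rw [((Polynomial.monic_X_pow_add_C _ (by omega)).pow _).natDegree_mul
      (Polynomial.monic_X_pow _), (Polynomial.monic_X_pow_add_C _ (by omega)).natDegree_pow,
      Polynomial.natDegree_X_pow_add_C, Polynomial.natDegree_X_pow, mul_comm]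
  have hcoeff : ∀ m, (term m).coeff (wt m) = Polynomial.C (g.coeff m) := by
    intro m
    simp only [term]
    rw [Polynomial.coeff_C_mul, ← hdegm m, (hmon m).coeff_natDegree, mul_one]
  have hdegt : ∀ m, (term m).natDegree ≤ wt m := by
    intro m
    rw [← hdegm m]
    exact Polynomial.natDegree_C_mul_le _ _
  have hlt : ∀ m ∈ g.support, m 1 < N := by
    intro m hm
    have h1 := MvPolynomial.le_totalDegree hm
    rw [Finsupp.sum_fintype _ _ (by simp), Fin.sum_univ_two] at h1
    omega
  have hwinj : ∀ m ∈ g.support, ∀ m' ∈ g.support, wt m = wt m' → m = m' := by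
    intro m hm m' hm' h
    have h1 := hlt m hm
    have h2 := hlt m' hm'
    have h3 : m 1 = m' 1 := by
      have := congrArg (· % N) h
      simpa [wt, Nat.mod_eq_of_lt h1, Nat.mod_eq_of_lt h2] using this
    have h4 : m 0 = m' 0 := by
      simp only [wt, h3] at h
      have : N * m 0 = N * m' 0 := by omega
      exact Nat.eq_of_mul_eq_mul_left (by omega) this
    ext i
    fin_cases i
    · exact h4
    · exact h3
  have hex : ∃ m ∈ g.support, m ≠ 0 := by
    by_contra hno
    push Not at hno
    apply hg (g.coeff 0)
    ext m
    rw [MvPolynomial.coeff_C]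
    split_ifs with h
    · rw [h]
    · by_contra hne
      exact h (hno m (MvPolynomial.mem_support_iff.2 hne)).symm
  obtain ⟨m₁, hm₁, hm₁0⟩ := hex
  obtain ⟨m, hm, hmax⟩ := Finset.exists_max_image g.support wt ⟨m₁, hm₁⟩
  have hG : G.coeff (wt m) = Polynomial.C (g.coeff m) := by
    rw [Polynomial.finsetSum_coeff, Finset.sum_eq_single m]
    · exact hcoeff m
    · intro m' hm' hne
      apply Polynomial.coeff_eq_zero_of_natDegree_lt
      refine (hdegt m').trans_lt (lt_of_le_of_ne (hmax m' hm') ?_)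
      intro h
      exact hne (hwinj _ hm' _ hm h)
    · intro h; exact absurd hm h
  have ha : g.coeff m ≠ 0 := MvPolynomial.mem_support_iff.1 hm
  refine ⟨N, G, wt m, g.coeff m, ha, ?_, ?_, hG, ?_⟩
  · refine le_trans ?_ (hmax m₁ hm₁)
    by_contra hlt1
    apply hm₁0
    have h0 : wt m₁ = 0 := by omega
    simp only [wt, Nat.add_eq_zero_iff, Nat.mul_eq_zero] at h0
    ext i
    fin_cases i
    · exact h0.1.resolve_left (by omega)
    · exact h0.2
  · apply le_antisymm
    · apply Polynomial.natDegree_sum_le_of_forall_le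
      intro m' hm'
      exact (hdegt m').trans (hmax m' hm')
    · apply Polynomial.le_natDegree_of_ne_zero
      rw [hG]
      exact Polynomial.C_ne_zero.2 ha
  · intro x y
    rw [MvPolynomial.eval_eq', Polynomial.evalEval_finsetSum]
    apply Finset.sum_congr rfl
    intro m' _
    simp only [term, Polynomial.evalEval_mul, Polynomial.evalEval_pow, Polynomial.evalEval_add,
      Polynomial.evalEval_C, Polynomial.evalEval_X, Polynomial.eval_C, Polynomial.eval_X,
      Fin.prod_univ_two]
    simp [add_comm]

/-- The discriminant-like polynomial. -/
theorem exists_disc (G : Polynomial (Polynomial ℂ)) (n : ℕ) (a : ℂ) (ha : a ≠ 0) (hn : 1 ≤ n)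
    (hdeg : G.natDegree = n) (hlc : G.coeff n = Polynomial.C a) :
    ∃ Q : Polynomial (Polynomial ℂ), Q ≠ 0 ∧
      ∀ x y, G.derivative.evalEval x y = 0 → Q.evalEval (G.evalEval x y) x = 0 := by
  let D : Polynomial (Polynomial ℂ) :=
    Polynomial.C (Polynomial.C ((n * a)⁻¹)) * G.derivative
  have hna : (n * a : ℂ) ≠ 0 := mul_ne_zero (by exact_mod_cast (by omega)) ha
  have hD : D.Monic := by
    apply Polynomial.monic_of_natDegree_le_of_coeff_eq_one (n - 1)
    · refine (Polynomial.natDegree_C_mul_le _ _).trans ?_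
      rw [← hdeg]
      exact Polynomial.natDegree_derivative_le G
    · simp only [D]
      rw [Polynomial.coeff_C_mul, Polynomial.coeff_derivative]
      have h1 : n - 1 + 1 = n := by omega
      have h2 : ((n - 1 : ℕ) : Polynomial ℂ) + 1 = Polynomial.C (n : ℂ) := by
        rw [← Nat.cast_add_one, h1]; simp
      rw [h1, hlc, h2, ← Polynomial.C_mul, ← Polynomial.C_mul, mul_comm a, inv_mul_cancel₀ hna,
        Polynomial.C_1]
  have := hD.finite_adjoinRoot
  obtain ⟨Q, hQm, hQ⟩ := Algebra.IsIntegral.isIntegral (R := Polynomial ℂ) (AdjoinRoot.mk D G)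
  refine ⟨Polynomial.Bivariate.swap Q, ?_, ?_⟩
  · intro h
    rw [EmbeddingLike.map_eq_zero_iff] at h
    exact hQm.ne_zero h
  · intro x y hxy
    have hsw : ∀ u v, (Polynomial.Bivariate.swap Q).evalEval u v = Q.evalEval v u := by
      intro u v
      have := Polynomial.Bivariate.aevalAeval_swap (R := ℂ) (A := ℂ) u v Q
      rwa [Polynomial.coe_aevalAeval_eq_evalEval, Polynomial.coe_aevalAeval_eq_evalEval] at this
    rw [hsw]
    have h1 : AdjoinRoot.mk D (Polynomial.eval₂ Polynomial.C G Q) = 0 := by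
      rw [Polynomial.hom_eval₂]
      exact hQ
    rw [AdjoinRoot.mk_eq_zero] at h1
    have h2 := Polynomial.evalEval_dvd x y h1
    have h3 : D.evalEval x y = 0 := by
      simp only [D]
      rw [Polynomial.evalEval_mul, hxy, mul_zero]
    rw [h3, zero_dvd_iff, ← Polynomial.coe_evalEvalRingHom, Polynomial.hom_eval₂] at h2
    have h4 : (Polynomial.evalEvalRingHom x y).comp Polynomial.C = Polynomial.evalRingHom x := by
      ext <;> simp
    rw [h4, Polynomial.eval₂_evalRingHom] at h2
    exact h2

/-- bivariate polynomials as polynomials in three variables -/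
theorem exists_mv (P : Polynomial (Polynomial ℂ)) (i j : Fin 3) :
    ∃ F : MvPolynomial (Fin 3) ℂ, ∀ z, MvPolynomial.eval z F = P.evalEval (z i) (z j) := by
  refine ⟨P.eval₂ (Polynomial.eval₂RingHom MvPolynomial.C (MvPolynomial.X i))
    (MvPolynomial.X j), fun z => ?_⟩
  rw [Polynomial.hom_eval₂, MvPolynomial.eval_X]
  have : (MvPolynomial.eval z).comp (Polynomial.eval₂RingHom MvPolynomial.C (MvPolynomial.X i)) =
      Polynomial.evalRingHom (z i) := by
    ext <;> simp
  rw [this, Polynomial.eval₂_evalRingHom]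

theorem ncard_fibered (A : Finset ℂ) (Z : ℂ → Set ℂ) (hZ : ∀ x, (Z x).Finite) :
    {p : ℂ × ℂ | p.1 ∈ A ∧ p.2 ∈ Z p.1}.Finite ∧
    {p : ℂ × ℂ | p.1 ∈ A ∧ p.2 ∈ Z p.1}.ncard = ∑ x ∈ A, (Z x).ncard := by
  classical
  have h : {p : ℂ × ℂ | p.1 ∈ A ∧ p.2 ∈ Z p.1} =
      ((A.sigma (fun x => (hZ x).toFinset)).image (fun q => (q.1, q.2)) : Finset (ℂ × ℂ)) := by
    ext ⟨x, y⟩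
    simp
  rw [h]
  refine ⟨Finset.finite_toSet _, ?_⟩
  rw [Set.ncard_coe_finset, Finset.card_image_of_injective, Finset.card_sigma]
  · apply Finset.sum_congr rfl
    intro x _
    rw [Set.ncard_eq_toFinset_card _ (hZ x)]
  · rintro ⟨x, y⟩ ⟨x', y'⟩ h
    simp only [Prod.mk.injEq] at h
    obtain ⟨rfl, rfl⟩ := h
    rfl

section Helpers
open Topology Filter unitInterval

/-- A continuous family of finite subsets of `ℂ`. -/
structure RootFam {W : Type*} [TopologicalSpace W] (Z : W → Set ℂ) : Prop where
  fin : ∀ w, (Z w).Finite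
  upper : ∀ w₀, ∀ O : Set ℂ, IsOpen O → Z w₀ ⊆ O → ∀ᶠ w in 𝓝 w₀, Z w ⊆ O
  lower : ∀ w₀, ∀ O : Set ℂ, IsOpen O → (Z w₀ ∩ O).Nonempty → ∀ᶠ w in 𝓝 w₀, (Z w ∩ O).Nonempty

theorem RootFam.comp {W W' : Type*} [TopologicalSpace W] [TopologicalSpace W'] {Z : W → Set ℂ}
    (hZ : RootFam Z) {f : W' → W} (hf : Continuous f) : RootFam (fun w => Z (f w)) where
  fin w := hZ.fin _
  upper w O hO h := hf.continuousAt.eventually (hZ.upper _ O hO h)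
  lower w O hO h := hf.continuousAt.eventually (hZ.lower _ O hO h)

theorem exists_sep (A : Set ℂ) (hA : A.Finite) :
    ∃ ε > 0, ∀ a ∈ A, ∀ b ∈ A, dist a b < ε → a = b := by
  by_cases hs : A.Subsingleton
  · exact ⟨1, one_pos, fun a ha b hb _ => hs ha hb⟩
  · rw [Set.not_subsingleton_iff] at hs
    have := Set.Finite.infsep_pos_iff_nontrivial (s := A) hA |>.2 hs
    refine ⟨A.infsep, this, fun a ha b hb h => ?_⟩
    by_contra hab
    exact absurd (Set.infsep_le_dist_of_mem ha hb hab) (not_le.2 h)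

/-- lower semicontinuity of the count -/
theorem RootFam.ncard_le {W : Type*} [TopologicalSpace W] {Z : W → Set ℂ} (hZ : RootFam Z)
    (w₀ : W) : ∀ᶠ w in 𝓝 w₀, (Z w₀).ncard ≤ (Z w).ncard := by
  obtain ⟨ε, hε, hsep⟩ := exists_sep (Z w₀) (hZ.fin w₀)
  have h1 : ∀ᶠ w in 𝓝 w₀, ∀ a ∈ Z w₀, (Z w ∩ Metric.ball a (ε/2)).Nonempty := by
    rw [eventually_all_finite (hZ.fin w₀)]
    intro a ha
    exact hZ.lower w₀ _ Metric.isOpen_ball ⟨a, ha, Metric.mem_ball_self (by positivity)⟩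
  filter_upwards [h1] with w hw
  choose! y hy using hw
  refine Set.ncard_le_ncard_of_injOn y (fun a ha => (hy a ha).1) ?_ (hZ.fin w)
  intro a ha b hb hab
  apply hsep a ha b hb
  have h1 := (hy a ha).2
  have h2 := (hy b hb).2
  rw [Metric.mem_ball] at h1 h2
  rw [hab] at h1
  calc dist a b ≤ dist (y b) a + dist (y b) b := dist_triangle_left _ _ _
    _ < ε := by linarith

theorem RootFam.sheets {W : Type*} [TopologicalSpace W] {Z : W → Set ℂ} (hZ : RootFam Z)
    (w₀ : W) (hc : ∀ᶠ w in 𝓝 w₀, (Z w).ncard = (Z w₀).ncard) :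
    ∃ V : Set W, IsOpen V ∧ w₀ ∈ V ∧ ∃ ε > 0, ∃ y : ℂ → W → ℂ,
      (∀ a ∈ Z w₀, y a w₀ = a) ∧ (∀ a ∈ Z w₀, ContinuousOn (y a) V) ∧
      (∀ w ∈ V, Set.InjOn (fun a => y a w) (Z w₀)) ∧
      (∀ w ∈ V, (fun a => y a w) '' (Z w₀) = Z w) ∧
      (∀ w ∈ V, ∀ a ∈ Z w₀, ∀ z ∈ Z w, dist z a < ε → z = y a w) := by
  obtain ⟨ε, hε, hsep⟩ := exists_sep (Z w₀) (hZ.fin w₀)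
  have h1 : ∀ᶠ w in 𝓝 w₀, ∀ a ∈ Z w₀, (Z w ∩ Metric.ball a (ε/2)).Nonempty := by
    rw [eventually_all_finite (hZ.fin w₀)]
    intro a ha
    exact hZ.lower w₀ _ Metric.isOpen_ball ⟨a, ha, Metric.mem_ball_self (by positivity)⟩
  obtain ⟨V, hV, hVo, hw₀⟩ := eventually_nhds_iff.1 (h1.and hc)
  have hV1 := fun w hw => (hV w hw).1
  have hV2 := fun w hw => (hV w hw).2
  choose! y' hy using hV1
  have hinj : ∀ w ∈ V, Set.InjOn (fun a => y' w a) (Z w₀) := by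
    intro w hw a ha b hb hab
    apply hsep a ha b hb
    have h1 := (hy w hw a ha).2
    have h2 := (hy w hw b hb).2
    simp only [Metric.mem_ball] at h1 h2 hab
    rw [hab] at h1
    calc dist a b ≤ dist (y' w b) a + dist (y' w b) b := dist_triangle_left _ _ _
      _ < ε := by linarith
  have himg : ∀ w ∈ V, (fun a => y' w a) '' (Z w₀) = Z w := by
    intro w hw
    refine Set.eq_of_subset_of_ncard_le ?_ ?_ (hZ.fin w)
    · rintro _ ⟨a, ha, rfl⟩
      exact (hy w hw a ha).1
    · rw [Set.InjOn.ncard_image (hinj w hw), hV2 w hw]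
  have huniq : ∀ w ∈ V, ∀ a ∈ Z w₀, ∀ z ∈ Z w, dist z a < ε/2 → z = y' w a := by
    intro w hw a ha z hz hd
    rw [← himg w hw] at hz
    obtain ⟨b, hb, rfl⟩ := hz
    have h2 := (hy w hw b hb).2
    simp only [Metric.mem_ball] at h2 hd
    have : a = b := by
      apply hsep a ha b hb
      calc dist a b ≤ dist (y' w b) a + dist (y' w b) b := dist_triangle_left _ _ _
        _ < ε := by linarith
    subst this; rfl
  refine ⟨V, hVo, hw₀, ε/2, by positivity, fun a w => y' w a, ?_, ?_, hinj, himg, huniq⟩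
  · intro a ha
    exact (huniq w₀ hw₀ a ha a ha (by simpa using hε)).symm
  · intro a ha w hw
    apply ContinuousAt.continuousWithinAt
    rw [Metric.continuousAt_iff']
    intro δ hδ
    have h3 := (hy w hw a ha)
    have := hZ.lower w (Metric.ball a (ε/2) ∩ Metric.ball (y' w a) δ)
      (Metric.isOpen_ball.inter Metric.isOpen_ball) ⟨y' w a, h3.1, h3.2, Metric.mem_ball_self hδ⟩
    filter_upwards [this, hVo.mem_nhds hw] with v hv hvV
    obtain ⟨z, hz, hz1, hz2⟩ := hv
    rw [← huniq v hvV a ha z hz hz1]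
    exact hz2

/-- path lifting -/
theorem RootFam.exists_path {Z : I → Set ℂ} (hZ : RootFam Z)
    (hc : ∀ s, (Z s).ncard = (Z 0).ncard) (y₀ : ℂ) (hy₀ : y₀ ∈ Z 0) :
    ∃ γ : I → ℂ, Continuous γ ∧ γ 0 = y₀ ∧ ∀ s, γ s ∈ Z s := by
  have hsh := fun s₀ => hZ.sheets s₀ (Eventually.of_forall fun s => (hc s).trans (hc s₀).symm)
  choose V hVo hVm ε hε y hy0 hycont hyinj hyimg hyu using hsh
  obtain ⟨t, ht0, htm, ⟨m, htm1⟩, hts⟩ :=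
    exists_monotone_Icc_subset_open_cover_unitInterval hVo
      (fun s _ => Set.mem_iUnion.2 ⟨s, hVm s⟩)
  have key : ∀ n, ∃ γ : I → ℂ, ContinuousOn γ (Set.Icc 0 (t n)) ∧ γ 0 = y₀ ∧
      ∀ s ∈ Set.Icc 0 (t n), γ s ∈ Z s := by
    intro n
    induction n with
    | zero =>
      refine ⟨fun _ => y₀, continuousOn_const, rfl, ?_⟩
      intro s hs
      rw [ht0, Set.Icc_self, Set.mem_singleton_iff] at hs
      rw [hs]; exact hy₀
    | succ n ih =>
      obtain ⟨γ, hγc, hγ0, hγZ⟩ := ih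
      obtain ⟨i, hi⟩ := hts n
      have hle : t n ≤ t (n+1) := htm (Nat.le_succ n)
      have h0 : (0 : I) ≤ t n := unitInterval.nonneg'
      have hmem : γ (t n) ∈ Z (t n) := hγZ _ ⟨h0, le_rfl⟩
      rw [← hyimg i (t n) (hi ⟨le_rfl, hle⟩)] at hmem
      obtain ⟨a, ha, hae⟩ := hmem
      have e1 : Set.EqOn (fun s => if s ≤ t n then γ s else y i a s) γ (Set.Icc 0 (t n)) := by
        intro s hs; simp [hs.2]
      have e2 : Set.EqOn (fun s => if s ≤ t n then γ s else y i a s) (y i a)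
          (Set.Icc (t n) (t (n+1))) := by
        intro s hs
        by_cases h : s ≤ t n
        · have : s = t n := le_antisymm h hs.1
          subst this
          simpa using hae.symm
        · simp [h]
      refine ⟨fun s => if s ≤ t n then γ s else y i a s, ?_, ?_, ?_⟩
      · rw [← Set.Icc_union_Icc_eq_Icc h0 hle]
        apply ContinuousOn.union_of_isClosed _ _ isClosed_Icc isClosed_Icc
        · exact hγc.congr e1
        · exact ((hycont i a ha).mono hi).congr e2
      · simp [h0, hγ0]
      · intro s hs
        by_cases h : s ≤ t n
        · simp only [h, if_true]; exact hγZ s ⟨hs.1, h⟩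
        · simp only [h, if_false]
          rw [← hyimg i s (hi ⟨(not_le.1 h).le, hs.2⟩)]
          exact ⟨a, ha, rfl⟩
  obtain ⟨γ, h1, h2, h3⟩ := key m
  rw [htm1 m le_rfl] at h1 h3
  have : Set.Icc (0:I) 1 = Set.univ := by
    ext s; simp [unitInterval.nonneg', unitInterval.le_one']
  rw [this] at h1 h3
  exact ⟨γ, continuousOn_univ.1 h1, h2, fun s => h3 s trivial⟩

/-- uniform isolation of a path -/
theorem RootFam.isolated {Z : I → Set ℂ} (hZ : RootFam Z)
    (hc : ∀ s, (Z s).ncard = (Z 0).ncard) (γ : I → ℂ) (hγ : Continuous γ) (hγZ : ∀ s, γ s ∈ Z s) :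
    ∃ ε > 0, ∀ s, ∀ z ∈ Z s, dist z (γ s) < ε → z = γ s := by
  have : ∃ ε > 0, ∀ s ∈ (Set.univ : Set I), ∀ z ∈ Z s, dist z (γ s) < ε → z = γ s := by
    refine isCompact_univ.induction_on (p := fun S => ∃ ε > 0, ∀ s ∈ S, ∀ z ∈ Z s,
      dist z (γ s) < ε → z = γ s) ?_ ?_ ?_ ?_
    · exact ⟨1, one_pos, by simp⟩
    · rintro s t hst ⟨ε, hε, h⟩
      exact ⟨ε, hε, fun x hx => h x (hst hx)⟩
    · rintro s t ⟨ε, hε, h⟩ ⟨ε', hε', h'⟩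
      refine ⟨min ε ε', lt_min hε hε', ?_⟩
      rintro x (hx | hx) z hz hd
      · exact h x hx z hz (hd.trans_le (min_le_left _ _))
      · exact h' x hx z hz (hd.trans_le (min_le_right _ _))
    · intro s₀ _
      obtain ⟨V, hVo, hs₀, ε, hε, y, -, -, -, -, hu⟩ := hZ.sheets s₀
        (Eventually.of_forall fun s => (hc s).trans (hc s₀).symm)
      have h1 : ∀ᶠ s in 𝓝 s₀, dist (γ s) (γ s₀) < ε / 2 :=
        Metric.continuousAt_iff'.1 hγ.continuousAt _ (by positivity)
      refine ⟨_, mem_nhdsWithin_of_mem_nhds (h1.and (hVo.mem_nhds hs₀)), ε/2, by positivity, ?_⟩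
      rintro s ⟨hs1, hs2⟩ z hz hd
      replace hs1 : dist (γ s) (γ s₀) < ε / 2 := hs1
      rw [hu s hs2 _ (hγZ s₀) z hz, ← hu s hs2 _ (hγZ s₀) (γ s) (hγZ s) (by linarith)]
      calc dist z (γ s₀) ≤ dist z (γ s) + dist (γ s) (γ s₀) := dist_triangle _ _ _
        _ < ε := by linarith
  obtain ⟨ε, hε, h⟩ := this
  exact ⟨ε, hε, fun s => h s trivial⟩

/-- nearby paths stay close -/
theorem RootFam.stay {W : Type*} [TopologicalSpace W] {Z : W × I → Set ℂ} (hZ : RootFam Z)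
    (hc : ∀ w s, (Z (w, s)).ncard = (Z (w, 0)).ncard) (w₀ : W) (γ : I → ℂ) (hγ : Continuous γ)
    (hγZ : ∀ s, γ s ∈ Z (w₀, s)) (ε : ℝ) (hε : 0 < ε) :
    ∃ δ > 0, ∀ᶠ w in 𝓝 w₀, ∀ γ' : I → ℂ, Continuous γ' → (∀ s, γ' s ∈ Z (w, s)) →
      ∀ s₁, dist (γ' s₁) (γ s₁) < δ → ∀ s, dist (γ' s) (γ s) < ε := by
  obtain ⟨e, he, hiso⟩ := RootFam.isolated (hZ.comp (f := fun s : I => (w₀, s)) (by fun_prop))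
    (hc w₀) γ hγ hγZ
  set r := min ε (e/2) with hr
  have hr0 : 0 < r := lt_min hε (by positivity)
  have hre : 2 * r ≤ e := by have := min_le_right ε (e/2); linarith
  have gap : ∀ᶠ w in 𝓝 w₀, ∀ s ∈ (Set.univ : Set I), ∀ z ∈ Z (w, s),
      dist z (γ s) < r → dist z (γ s) ≤ r/2 := by
    apply isCompact_univ.eventually_forall_of_forall_eventually
    intro s₀ _
    have h1 : ∀ᶠ p in 𝓝 (w₀, s₀), Z p ⊆
        Metric.ball (γ s₀) (r/4) ∪ (Metric.closedBall (γ s₀) (3*r/2))ᶜ := by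
      apply hZ.upper _ _ (Metric.isOpen_ball.union Metric.isClosed_closedBall.isOpen_compl)
      intro z hz
      by_cases h : dist z (γ s₀) ≤ 3 * r/2
      · left
        rw [hiso s₀ z hz (by linarith)]
        exact Metric.mem_ball_self (by positivity)
      · right; simpa using h
    have h2 : ∀ᶠ p : W × I in 𝓝 (w₀, s₀), dist (γ p.2) (γ s₀) < r/4 := by
      have : Continuous (fun p : W × I => γ p.2) := by fun_prop
      exact Metric.continuousAt_iff'.1 (this.continuousAt (x := (w₀, s₀))) _ (by positivity)
    filter_upwards [h1, h2] with p hp1 hp2 z hz hd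
    rcases hp1 hz with h | h
    · rw [Metric.mem_ball] at h
      have := dist_triangle_right z (γ p.2) (γ s₀)
      linarith
    · simp only [Set.mem_compl_iff, Metric.mem_closedBall, not_le] at h
      have := dist_triangle z (γ p.2) (γ s₀)
      linarith
  refine ⟨r, hr0, ?_⟩
  filter_upwards [gap] with w hw γ' hγ' hγ'Z s₁ hs₁ s
  have hcl : IsClopen {s | dist (γ' s) (γ s) < r} := by
    constructor
    · have : {s | dist (γ' s) (γ s) < r} = {s | dist (γ' s) (γ s) ≤ r/2} := by
        ext s
        exact ⟨fun h => hw s trivial _ (hγ'Z s) h, fun h => lt_of_le_of_lt h (half_lt_self hr0)⟩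
      rw [this]
      exact isClosed_le (by fun_prop) continuous_const
    · exact isOpen_lt (by fun_prop) continuous_const
  have := hcl.eq_univ ⟨s₁, hs₁⟩
  have h3 : s ∈ {s | dist (γ' s) (γ s) < r} := this ▸ trivial
  exact lt_of_lt_of_le h3 (min_le_left _ _)

theorem RootFam.path_unique {Z : I → Set ℂ} (hZ : RootFam Z)
    (hc : ∀ s, (Z s).ncard = (Z 0).ncard) (γ γ' : I → ℂ) (hγ : Continuous γ)
    (hγZ : ∀ s, γ s ∈ Z s) (hγ' : Continuous γ') (hγZ' : ∀ s, γ' s ∈ Z s) (s₁ : I)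
    (h : γ' s₁ = γ s₁) : γ' = γ := by
  funext s
  apply eq_of_forall_dist_le
  intro ε hε
  obtain ⟨δ, hδ, hev⟩ := RootFam.stay (W := Unit) (hZ.comp (f := Prod.snd) continuous_snd)
    (fun _ => hc) () γ hγ hγZ ε hε
  exact (hev.self_of_nhds γ' hγ' hγZ' s₁ (by simpa [h] using hδ) s).le

theorem RootFam.exists_path_one {Z : I → Set ℂ} (hZ : RootFam Z)
    (hc : ∀ s, (Z s).ncard = (Z 0).ncard) (y₀ : ℂ) (hy₀ : y₀ ∈ Z 1) :
    ∃ γ : I → ℂ, Continuous γ ∧ γ 1 = y₀ ∧ ∀ s, γ s ∈ Z s := by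
  obtain ⟨γ, h1, h2, h3⟩ := RootFam.exists_path (hZ.comp (f := unitInterval.symm) (by fun_prop))
    (fun s => (hc _).trans (hc _).symm) y₀ (by simpa using hy₀)
  refine ⟨fun s => γ (unitInterval.symm s), by fun_prop, by simpa using h2, fun s => ?_⟩
  simpa using h3 (unitInterval.symm s)

/-- parallel transport as a homeomorphism -/
theorem RootFam.transport {W : Type*} [TopologicalSpace W] {Z : W × I → Set ℂ} (hZ : RootFam Z)
    (hc : ∀ w s, (Z (w, s)).ncard = (Z (w, 0)).ncard) :
    ∃ τ : {p : W × ℂ // p.2 ∈ Z (p.1, 0)} ≃ₜ {p : W × ℂ // p.2 ∈ Z (p.1, 1)},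
      ∀ p, (τ p).1.1 = p.1.1 := by
  have hZw : ∀ w, RootFam (fun s : I => Z (w, s)) := fun w =>
    hZ.comp (f := fun s : I => (w, s)) (by fun_prop)
  have hA : ∀ p : {p : W × ℂ // p.2 ∈ Z (p.1, 0)}, ∃ γ : I → ℂ, Continuous γ ∧ γ 0 = p.1.2 ∧
      ∀ s, γ s ∈ Z (p.1.1, s) := fun p => (hZw p.1.1).exists_path (hc _) p.1.2 p.2
  have hB : ∀ p : {p : W × ℂ // p.2 ∈ Z (p.1, 1)}, ∃ γ : I → ℂ, Continuous γ ∧ γ 1 = p.1.2 ∧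
      ∀ s, γ s ∈ Z (p.1.1, s) := fun p => (hZw p.1.1).exists_path_one (hc _) p.1.2 p.2
  choose α hα1 hα2 hα3 using hA
  choose β hβ1 hβ2 hβ3 using hB
  have hαe : ∀ p w y (h : y ∈ Z (w, 0)), w = p.1.1 → y = β p 0 → α ⟨(w, y), h⟩ = β p := by
    rintro p w y h rfl rfl
    exact (hZw p.1.1).path_unique (hc _) _ _ (hβ1 _) (hβ3 _) (hα1 _) (hα3 ⟨(p.1.1, β p 0), h⟩) 0
      (hα2 _)
  have hβe : ∀ p w y (h : y ∈ Z (w, 1)), w = p.1.1 → y = α p 1 → β ⟨(w, y), h⟩ = α p := by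
    rintro p w y h rfl rfl
    exact (hZw p.1.1).path_unique (hc _) _ _ (hα1 _) (hα3 _) (hβ1 _) (hβ3 ⟨(p.1.1, α p 1), h⟩) 1
      (hβ2 _)
  refine ⟨{ toFun := fun p => ⟨(p.1.1, α p 1), hα3 p 1⟩
            invFun := fun p => ⟨(p.1.1, β p 0), hβ3 p 0⟩
            left_inv := ?_
            right_inv := ?_
            continuous_toFun := ?_
            continuous_invFun := ?_ }, fun p => rfl⟩
  · intro p
    ext1
    refine Prod.ext rfl ?_
    simp only
    rw [hβe p _ _ _ rfl rfl, hα2]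
  · intro p
    ext1
    refine Prod.ext rfl ?_
    simp only
    rw [hαe p _ _ _ rfl rfl, hβ2]
  · refine Continuous.subtype_mk (Continuous.prodMk (by fun_prop) ?_) _
    rw [continuous_iff_continuousAt]
    intro p
    rw [Metric.continuousAt_iff']
    intro ε hε
    obtain ⟨δ, hδ, hev⟩ := hZ.stay hc p.1.1 (α p) (hα1 p) (hα3 p) ε hε
    have h1 : ContinuousAt (fun q : {p : W × ℂ // p.2 ∈ Z (p.1, 0)} => q.1.1) p := by fun_prop
    have h2 : ContinuousAt (fun q : {p : W × ℂ // p.2 ∈ Z (p.1, 0)} => q.1.2) p := by fun_prop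
    filter_upwards [h1.eventually hev, Metric.continuousAt_iff'.1 h2 δ hδ] with q hq hq2
    exact hq (α q) (hα1 q) (hα3 q) 0 (by rw [hα2, hα2]; exact hq2) 1
  · refine Continuous.subtype_mk (Continuous.prodMk (by fun_prop) ?_) _
    rw [continuous_iff_continuousAt]
    intro p
    rw [Metric.continuousAt_iff']
    intro ε hε
    obtain ⟨δ, hδ, hev⟩ := hZ.stay hc p.1.1 (β p) (hβ1 p) (hβ3 p) ε hε
    have h1 : ContinuousAt (fun q : {p : W × ℂ // p.2 ∈ Z (p.1, 1)} => q.1.1) p := by fun_prop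
    have h2 : ContinuousAt (fun q : {p : W × ℂ // p.2 ∈ Z (p.1, 1)} => q.1.2) p := by fun_prop
    filter_upwards [h1.eventually hev, Metric.continuousAt_iff'.1 h2 δ hδ] with q hq hq2
    exact hq (β q) (hβ1 q) (hβ3 q) 1 (by rw [hβ2, hβ2]; exact hq2) 0

theorem bump_lip (r : ℝ) (hr : 0 < r) (a x x' : ℂ) :
    |max 0 (1 - dist x a / r) - max 0 (1 - dist x' a / r)| ≤ dist x x' / r := by
  refine (abs_max_sub_max_le_max _ _ _ _).trans ?_
  simp only [sub_self, abs_zero]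
  apply max_le (by positivity)
  have : 1 - dist x a / r - (1 - dist x' a / r) = (dist x' a - dist x a) / r := by ring
  rw [this, abs_div, abs_of_pos hr]
  gcongr
  rw [dist_comm x x']
  exact abs_dist_sub_le _ _ _

theorem isotopy (A : Finset ℂ) (t₀ : ℂ) (V₀ : Set ℂ) (hV₀ : IsOpen V₀) (ht₀ : t₀ ∈ V₀)
    (ξ : ℂ → ℂ → ℂ) (hξ0 : ∀ a ∈ A, ξ a t₀ = a) (hξ : ∀ a ∈ A, ContinuousOn (ξ a) V₀) :
    ∃ ρ > (0 : ℝ), ∃ B : Set ℂ, (∀ z, z ∈ B ↔ dist z t₀ < ρ) ∧ IsOpen B ∧ B ⊆ V₀ ∧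
      ∃ H : (B × ℂ) ≃ₜ (B × ℂ),
      (∀ p, (H p).1 = p.1) ∧ (∀ t x, t.1 = t₀ → (H (t, x)).2 = x) ∧
      (∀ t, ∀ a ∈ A, (H (t, a)).2 = ξ a t.1) := by
  obtain ⟨r, hr, hsep⟩ := exists_sep (A : Set ℂ) A.finite_toSet
  have hev : ∀ᶠ t in 𝓝 t₀, ∑ a ∈ A, dist (ξ a t) a < r / 2 := by
    have h1 : ContinuousAt (fun t => ∑ a ∈ A, dist (ξ a t) a) t₀ := by
      apply tendsto_finsetSum
      intro a ha
      exact (((hξ a ha).continuousAt (hV₀.mem_nhds ht₀)).dist continuousAt_const)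
    apply h1.eventually_lt continuousAt_const
    rw [Finset.sum_eq_zero]
    · positivity
    · intro a ha; rw [hξ0 a ha, dist_self]
  obtain ⟨ρ, hρ, hρs⟩ := Metric.eventually_nhds_iff_ball.1 (hev.and (hV₀.mem_nhds ht₀))
  refine ⟨ρ, hρ, Metric.ball t₀ ρ, fun _ => Metric.mem_ball, Metric.isOpen_ball,
    fun t ht => (hρs t ht).2, ?_⟩
  generalize Metric.ball t₀ ρ = B at hρs ⊢
  let b : ℂ → ℂ → ℝ := fun a x => max 0 (1 - dist x a / r)
  let d : ℂ → ℂ → ℂ := fun t x => ∑ a ∈ A, (b a x : ℂ) * (ξ a t - a)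
  have hblip : ∀ a x x', |b a x - b a x'| ≤ dist x x' / r := fun a x x' => bump_lip r hr a x x'
  have hbcont : ∀ a, Continuous (b a) := fun a => by fun_prop
  have hdlip : ∀ t ∈ B, ∀ x x', dist (d t x) (d t x') ≤ (1/2) * dist x x' := by
    intro t ht x x'
    rw [dist_eq_norm, ← Finset.sum_sub_distrib]
    calc ‖∑ a ∈ A, ((b a x : ℂ) * (ξ a t - a) - (b a x' : ℂ) * (ξ a t - a))‖
        ≤ ∑ a ∈ A, ‖((b a x : ℂ) * (ξ a t - a) - (b a x' : ℂ) * (ξ a t - a))‖ := norm_sum_le _ _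
      _ ≤ ∑ a ∈ A, (dist x x' / r) * dist (ξ a t) a := by
          apply Finset.sum_le_sum
          intro a ha
          rw [← sub_mul, norm_mul, ← Complex.ofReal_sub, Complex.norm_real, dist_eq_norm (ξ a t)]
          gcongr
          exact hblip a x x'
      _ = (dist x x' / r) * ∑ a ∈ A, dist (ξ a t) a := by rw [Finset.mul_sum]
      _ ≤ (dist x x' / r) * (r / 2) := by
          gcongr
          exact (hρs t ht).1.le
      _ = (1/2) * dist x x' := by field_simp
  have hdcont : Continuous (fun p : B × ℂ => d p.1.1 p.2) := by
    apply continuous_finsetSum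
    intro a ha
    have h1 : Continuous (fun p : B × ℂ => ξ a p.1.1) := by
      have : Continuous (fun t : B => ξ a t.1) :=
        ((hξ a ha).mono (fun t ht => (hρs t ht).2)).domRestrict
      exact this.comp continuous_fst
    exact (Complex.continuous_ofReal.comp ((hbcont a).comp continuous_snd)).mul
      (h1.sub continuous_const)
  have hexp : ∀ t ∈ B, ∀ x x', dist x x' ≤ 2 * dist (x + d t x) (x' + d t x') := by
    intro t ht x x'
    have h1 := hdlip t ht x x'
    have h2 : dist x x' ≤ dist (x + d t x) (x' + d t x') + dist (d t x) (d t x') := by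
      simp only [dist_eq_norm]
      calc ‖x - x'‖ = ‖((x + d t x) - (x' + d t x')) - (d t x - d t x')‖ := by congr 1; ring
        _ ≤ _ := norm_sub_le _ _
    linarith
  have hsurj : ∀ t ∈ B, ∀ z, ∃ x, x + d t x = z := by
    intro t ht z
    have hc : ContractingWith (1/2) (fun x => z - d t x) := by
      constructor
      · rw [← NNReal.coe_lt_coe]; norm_num
      · apply LipschitzWith.of_dist_le_mul
        intro x x'
        rw [dist_sub_left]
        simpa using hdlip t ht x x'
    refine ⟨hc.fixedPoint _, ?_⟩
    have := hc.fixedPoint_isFixedPt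
    rw [Function.IsFixedPt] at this
    exact (eq_sub_iff_add_eq.1 this.symm)
  have hsurj' : ∀ p : B × ℂ, ∃ x, x + d p.1.1 x = p.2 := fun p => hsurj p.1.1 p.1.2 p.2
  choose k hk using hsurj'
  have hinj : ∀ t ∈ B, ∀ x x', x + d t x = x' + d t x' → x = x' := by
    intro t ht x x' h
    have := hexp t ht x x'
    rw [h, dist_self, mul_zero] at this
    exact dist_le_zero.1 this
  refine ⟨{ toFun := fun p => (p.1, p.2 + d p.1.1 p.2)
            invFun := fun p => (p.1, k p)
            left_inv := ?_
            right_inv := ?_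
            continuous_toFun := continuous_fst.prodMk (continuous_snd.add hdcont)
            continuous_invFun := ?_ }, fun _ => rfl, ?_, ?_⟩
  · rintro ⟨t, x⟩
    refine Prod.ext rfl ?_
    exact hinj t.1 t.2 _ _ (hk (t, x + d t.1 x))
  · rintro ⟨t, z⟩
    exact Prod.ext rfl (hk (t, z))
  · refine continuous_fst.prodMk ?_
    rw [continuous_iff_continuousAt]
    intro p
    rw [ContinuousAt, tendsto_iff_dist_tendsto_zero]
    have hlim : Tendsto (fun q : B × ℂ => 2 * dist q.2 (k p + d q.1.1 (k p))) (𝓝 p) (𝓝 0) := by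
      have : Continuous (fun q : B × ℂ => 2 * dist q.2 (k p + d q.1.1 (k p))) := by
        have := hdcont.comp (f := fun q : B × ℂ => (q.1, k p)) (by fun_prop)
        have h2 : Continuous (fun q : B × ℂ => d q.1.1 (k p)) := this
        exact continuous_const.mul (continuous_snd.dist (continuous_const.add h2))
      have h3 := this.tendsto p
      simpa [hk p] using h3
    refine squeeze_zero (fun _ => dist_nonneg) (fun q => ?_) hlim
    have := hexp q.1.1 q.1.2 (k q) (k p)
    rwa [hk q] at this
  · intro t x ht
    have : d t.1 x = 0 := by
      apply Finset.sum_eq_zero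
      intro a ha
      rw [ht, hξ0 a ha, sub_self, mul_zero]
    simp [this]
  · intro t a ha
    have : d t.1 a = ξ a t.1 - a := by
      simp only [d]
      rw [Finset.sum_eq_single a]
      · simp [b]
      · intro c hc hca
        have : b c a = 0 := by
          simp only [b]
          apply max_eq_left
          have : r ≤ dist a c := by
            by_contra h
            exact hca (hsep a ha c hc (not_le.1 h)).symm
          rw [sub_nonpos, one_le_div hr]; exact this
        simp [this]
      · intro h; exact absurd ha h
    simp [this]

/-- topological core -/
theorem topo_core (G : ℂ → ℂ → ℂ) (hG : Continuous (fun p : ℂ × ℂ => G p.1 p.2))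
    (hZ : RootFam (fun p : ℂ × ℂ => {y | G p.1 y = p.2}))
    (n : ℕ) (A : Finset ℂ) (t₀ : ℂ) (V₀ : Set ℂ) (hV₀ : IsOpen V₀) (ht₀ : t₀ ∈ V₀)
    (ξ : ℂ → ℂ → ℂ) (hξ0 : ∀ a ∈ A, ξ a t₀ = a) (hξ : ∀ a ∈ A, ContinuousOn (ξ a) V₀)
    (hc1 : ∀ t ∈ V₀, ∀ x, (∀ a ∈ A, x ≠ ξ a t) → {y | G x y = t}.ncard = n)
    (hc2 : ∀ t ∈ V₀, ∀ a ∈ A, {y | G (ξ a t) y = t}.ncard = {y | G a y = t₀}.ncard) :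
    ∃ V : Set ℂ, IsOpen V ∧ t₀ ∈ V ∧ V ⊆ V₀ ∧ ∃ (T : Type) (_ : TopologicalSpace T)
      (φ : {p : ℂ × ℂ // G p.1 p.2 ∈ V} ≃ₜ V × T), ∀ e, ((φ e).1 : ℂ) = G e.1.1 e.1.2 := by
  obtain ⟨ρ, hρ, B, hBmem, hBo, hsub, H, hH1, hH0, hHa⟩ :=
    isotopy A t₀ V₀ hV₀ ht₀ ξ hξ0 hξ
  -- the contraction of the ball
  have hseg : ∀ (t : B) (s : I), t₀ + (s : ℝ) * (t.1 - t₀) ∈ B := by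
    intro t s
    have ht := (hBmem _).1 t.2
    rw [dist_eq_norm] at ht
    rw [hBmem, dist_eq_norm]
    rw [add_sub_cancel_left, norm_mul, Complex.norm_real, Real.norm_of_nonneg s.2.1]
    exact lt_of_le_of_lt (mul_le_of_le_one_left (norm_nonneg _) s.2.2) ht
  let c : B → I → B := fun t s => ⟨t₀ + (s : ℝ) * (t.1 - t₀), hseg t s⟩
  have hcc : Continuous (fun p : B × I => c p.1 p.2) := by
    apply Continuous.subtype_mk; fun_prop
  have hc0 : ∀ t, (c t 0).1 = t₀ := fun t => by simp [c]
  have hc1' : ∀ t, c t 1 = t := fun t => by ext; simp [c]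
  let f : (B × ℂ) × I → ℂ × ℂ := fun q => ((H (c q.1.1 q.2, q.1.2)).2, (c q.1.1 q.2).1)
  have hf : Continuous f := by
    have h1 : Continuous (fun q : (B × ℂ) × I => c q.1.1 q.2) :=
      hcc.comp (f := fun q : (B × ℂ) × I => (q.1.1, q.2)) (by fun_prop)
    fun_prop
  have hZf := hZ.comp hf
  have hcard : ∀ (w : B × ℂ) (s : I), {y | G (f (w, s)).1 y = (f (w, s)).2}.ncard =
      {y | G (f (w, 0)).1 y = (f (w, 0)).2}.ncard := by
    have aux : ∀ (w : B × ℂ) (s : I), {y | G (f (w, s)).1 y = (f (w, s)).2}.ncard =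
        if w.2 ∈ A then {y | G w.2 y = t₀}.ncard else n := by
      intro w s
      split_ifs with h
      · have : (f (w, s)).1 = ξ w.2 (c w.1 s).1 := hHa _ _ h
        rw [this]
        exact hc2 _ (hsub (c w.1 s).2) _ h
      · apply hc1 _ (hsub (c w.1 s).2)
        intro a ha heq
        rw [← hHa _ a ha] at heq
        have h2 : H (c w.1 s, w.2) = H (c w.1 s, a) := by
          refine Prod.ext ?_ heq
          rw [hH1, hH1]
        have h3 := congrArg Prod.snd (H.injective h2)
        simp only at h3
        exact h (h3 ▸ ha)
    intro w s
    rw [aux, aux]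
  obtain ⟨τ, hτ⟩ := hZf.transport hcard
  refine ⟨B, hBo, (hBmem t₀).2 (by simpa using hρ), hsub,
    {p : ℂ × ℂ // G p.1 p.2 = t₀}, inferInstance, ?_⟩
  -- Z₁ ≃ E
  have memE : ∀ p : {p : (B × ℂ) × ℂ // G (f (p.1, 1)).1 p.2 = (f (p.1, 1)).2},
      G (H p.1.1).2 p.1.2 = p.1.1.1.1 := by
    intro p
    have := p.2
    simpa [f, hc1'] using this
  let e1 : {p : ℂ × ℂ // G p.1 p.2 ∈ B} ≃ₜ
      {p : (B × ℂ) × ℂ // p.2 ∈ {y | G (f (p.1, 1)).1 y = (f (p.1, 1)).2}} :=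
    { toFun := fun p => ⟨(H.symm (⟨G p.1.1 p.1.2, p.2⟩, p.1.1), p.1.2), by
        have h1 : (H.symm (⟨G p.1.1 p.1.2, p.2⟩, p.1.1)).1 = ⟨G p.1.1 p.1.2, p.2⟩ := by
          rw [← hH1, H.apply_symm_apply]
        show G (H (c (H.symm (⟨G p.1.1 p.1.2, p.2⟩, p.1.1)).1 1, _)).2 p.1.2 = (c _ 1).1
        rw [hc1', Prod.mk.eta, H.apply_symm_apply, h1]⟩
      invFun := fun p => ⟨((H p.1.1).2, p.1.2), by
        rw [memE p]; exact p.1.1.1.2⟩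
      left_inv := by
        intro p
        ext1
        simp
      right_inv := by
        intro p
        ext1
        refine Prod.ext ?_ rfl
        simp only
        rw [H.symm_apply_eq]
        refine Prod.ext ?_ rfl
        rw [hH1]
        ext1
        exact memE p
      continuous_toFun := by
        have h1 : Continuous (fun p : {p : ℂ × ℂ // G p.1 p.2 ∈ B} =>
            (⟨G p.1.1 p.1.2, p.2⟩ : B)) := by
          apply Continuous.subtype_mk
          exact hG.comp continuous_subtype_val
        apply Continuous.subtype_mk
        fun_prop
      continuous_invFun := by
        apply Continuous.subtype_mk
        fun_prop }
  have he1 : ∀ p, (e1 p).1.1.1.1 = G p.1.1 p.1.2 := by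
    intro p
    have h1 : (H.symm (⟨G p.1.1 p.1.2, p.2⟩, p.1.1)).1 = ⟨G p.1.1 p.1.2, p.2⟩ := by
      rw [← hH1, H.apply_symm_apply]
    exact congrArg Subtype.val h1
  have mem0 : ∀ (w : B × ℂ) y, G (f (w, 0)).1 y = (f (w, 0)).2 ↔ G w.2 y = t₀ := by
    intro w y
    have h1 : (f (w, 0)).1 = w.2 := hH0 _ _ (hc0 _)
    have h2 : (f (w, 0)).2 = t₀ := hc0 _
    rw [h1, h2]
  let e0 : {p : (B × ℂ) × ℂ // p.2 ∈ {y | G (f (p.1, 0)).1 y = (f (p.1, 0)).2}} ≃ₜ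
      B × {p : ℂ × ℂ // G p.1 p.2 = t₀} :=
    { toFun := fun p => (p.1.1.1, ⟨(p.1.1.2, p.1.2), (mem0 _ _).1 p.2⟩)
      invFun := fun q => ⟨((q.1, q.2.1.1), q.2.1.2), (mem0 (q.1, q.2.1.1) _).2 q.2.2⟩
      left_inv := fun p => rfl
      right_inv := fun p => rfl
      continuous_toFun := by fun_prop
      continuous_invFun := by fun_prop }
  refine ⟨(e1.trans τ.symm).trans e0, ?_⟩
  intro e
  have h1 : (τ.symm (e1 e)).1.1 = (e1 e).1.1 := by
    rw [← hτ, τ.apply_symm_apply]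
  show ((τ.symm (e1 e)).1.1.1 : ℂ) = _
  rw [h1, he1]

theorem rootFam_of_poly {W : Type*} [TopologicalSpace W] (p : W → Polynomial ℂ) (n : ℕ)
    (hdeg : ∀ w, (p w).natDegree = n) (hne : ∀ w, p w ≠ 0)
    (hcoeff : ∀ i, Continuous (fun w => (p w).coeff i)) :
    RootFam (fun w => {y | (p w).eval y = 0}) := by
  have heval : Continuous (fun q : W × ℂ => (p q.1).eval q.2) := by
    have : (fun q : W × ℂ => (p q.1).eval q.2) =
        fun q => ∑ i ∈ Finset.range (n + 1), (p q.1).coeff i * q.2 ^ i := by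
      ext q
      rw [Polynomial.eval_eq_sum_range, hdeg]
    rw [this]
    apply continuous_finsetSum
    intro i _
    exact ((hcoeff i).comp continuous_fst).mul (continuous_snd.pow i)
  have hlead : ∀ w, (p w).coeff n ≠ 0 := by
    intro w
    rw [← hdeg w]
    exact Polynomial.leadingCoeff_ne_zero.2 (hne w)
  refine ⟨?_, ?_, ?_⟩
  · intro w
    refine ((p w).roots.toFinset.finite_toSet).subset ?_
    intro y hy
    simp only [Finset.mem_coe, Multiset.mem_toFinset]
    exact (Polynomial.mem_roots (hne w)).2 hy
  · intro w₀ O hO hsub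
    have hcb : Continuous (fun w => (p w).cauchyBound) := by
      have : (fun w => (p w).cauchyBound) = fun w =>
          (Finset.range n).sup (fun i => ‖(p w).coeff i‖₊) / ‖(p w).coeff n‖₊ + 1 := by
        ext w
        rw [Polynomial.cauchyBound, hdeg, Polynomial.leadingCoeff, hdeg]
      rw [this]
      refine Continuous.add (Continuous.div ?_ (hcoeff n).nnnorm ?_) continuous_const
      · apply Continuous.finset_sup_apply
        intro i _
        exact (hcoeff i).nnnorm
      · intro w
        exact nnnorm_ne_zero_iff.2 (hlead w)
    have h1 : ∀ᶠ w in 𝓝 w₀, (p w).cauchyBound < (p w₀).cauchyBound + 1 :=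
      hcb.continuousAt.eventually_lt continuousAt_const (lt_add_one _)
    have hK : IsCompact (Metric.closedBall (0 : ℂ) ((p w₀).cauchyBound + 1) \ O) :=
      (isCompact_closedBall _ _).diff hO
    have h2 : ∀ᶠ w in 𝓝 w₀, ∀ y ∈ Metric.closedBall (0 : ℂ) ((p w₀).cauchyBound + 1) \ O,
        (p w).eval y ≠ 0 := by
      apply hK.eventually_forall_of_forall_eventually (P := fun w y => (p w).eval y ≠ 0)
      intro y hy
      apply heval.continuousAt.eventually_ne
      intro h
      exact hy.2 (hsub h)
    filter_upwards [h1, h2] with w hw1 hw2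
    intro y hy
    by_contra hyO
    refine hw2 y ⟨?_, hyO⟩ hy
    have h3 := Polynomial.IsRoot.norm_lt_cauchyBound (hne w) (a := y) hy
    rw [mem_closedBall_zero_iff]
    have h4 : ‖y‖₊ ≤ (p w₀).cauchyBound + 1 := (h3.trans hw1).le
    exact_mod_cast h4
  · rintro w₀ O hO ⟨y₀, hy₀, hyO⟩
    obtain ⟨ε, hε, hball⟩ := Metric.isOpen_iff.1 hO y₀ hyO
    have hy₀ : (p w₀).eval y₀ = 0 := hy₀
    have h1 : ∀ᶠ w in 𝓝 w₀, ‖(p w).eval y₀‖ < ‖(p w).coeff n‖ * ε ^ n := by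
      have hc1 : Continuous (fun w => (p w).eval y₀) :=
        heval.comp (f := fun w => (w, y₀)) (by fun_prop)
      refine hc1.norm.continuousAt.eventually_lt
        ((hcoeff n).norm.mul continuous_const).continuousAt ?_
      rw [hy₀, norm_zero]
      have := norm_pos_iff.2 (hlead w₀)
      positivity
    filter_upwards [h1] with w hw
    by_contra hno
    rw [Set.not_nonempty_iff_eq_empty] at hno
    have hfar : ∀ z ∈ (p w).roots, ε ≤ ‖y₀ - z‖ := by
      intro z hz
      by_contra hlt
      have : z ∈ ({y | (p w).eval y = 0} ∩ O : Set ℂ) := by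
        refine ⟨(Polynomial.mem_roots (hne w)).1 hz, hball ?_⟩
        rw [Metric.mem_ball, dist_comm, dist_eq_norm]
        exact not_le.1 hlt
      rw [hno] at this
      exact this
    have hs := IsAlgClosed.splits (p w)
    rw [hs.eval_eq_prod_roots, Polynomial.leadingCoeff, hdeg, norm_mul] at hw
    have hcard : (p w).roots.card = n := by rw [← hs.natDegree_eq_card_roots, hdeg]
    have key : ∀ s : Multiset ℂ, (∀ z ∈ s, ε ≤ ‖y₀ - z‖) →
        ε ^ s.card ≤ ‖(s.map (y₀ - ·)).prod‖ := by
      intro s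
      induction s using Multiset.induction with
      | empty => intro _; simp
      | cons a s ih =>
        intro h
        rw [Multiset.card_cons, Multiset.map_cons, Multiset.prod_cons, norm_mul, pow_succ']
        have h1 := ih (fun z hz => h z (Multiset.mem_cons_of_mem hz))
        have h2 := h a (Multiset.mem_cons_self a s)
        gcongr
    have := key _ hfar
    rw [hcard] at this
    exact absurd hw (not_lt.2 (mul_le_mul_of_nonneg_left this (norm_nonneg _)))

/-- a polynomial without multiple roots has `natDegree` many roots -/
theorem ncard_roots_of_simple (p : Polynomial ℂ) (hp : p ≠ 0)
    (h : ∀ y, p.eval y = 0 → p.derivative.eval y ≠ 0) :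
    {y | p.eval y = 0}.ncard = p.natDegree := by
  classical
  have hnd : p.roots.Nodup := by
    rw [Multiset.nodup_iff_count_le_one]
    intro a
    rw [Polynomial.count_roots]
    by_contra hlt
    have h2 := (Polynomial.one_lt_rootMultiplicity_iff_isRoot hp).1 (not_le.1 hlt)
    exact h a h2.1 h2.2
  have : {y | p.eval y = 0} = (p.roots.toFinset : Set ℂ) := by
    ext y
    simp only [Finset.mem_coe, Multiset.mem_toFinset]
    exact (Polynomial.mem_roots hp).symm
  rw [this, Set.ncard_coe_finset, Multiset.toFinset_card_of_nodup hnd,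
    ← (IsAlgClosed.splits p).natDegree_eq_card_roots]

theorem exists_bif (G : Polynomial (Polynomial ℂ)) (n : ℕ) (a : ℂ) (ha : a ≠ 0) (hn : 1 ≤ n)
    (hdeg : G.natDegree = n) (hlc : G.coeff n = Polynomial.C a) :
    ∃ S : Set ℂ, S.Finite ∧ ∀ t₀ ∉ S, ∃ V : Set ℂ, IsOpen V ∧ t₀ ∈ V ∧ V ⊆ Sᶜ ∧
      ∃ (T : Type) (_ : TopologicalSpace T)
      (φ : {p : ℂ × ℂ // G.evalEval p.1 p.2 ∈ V} ≃ₜ V × T),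
        ∀ e, ((φ e).1 : ℂ) = G.evalEval e.1.1 e.1.2 := by
  classical
  obtain ⟨Q, hQ0, hQ⟩ := exists_disc G n a ha hn hdeg hlc
  let d := Q.natDegree
  let S₀ : Set ℂ := {t | Q.leadingCoeff.eval t = 0}
  have hlQ : Q.leadingCoeff ≠ 0 := Polynomial.leadingCoeff_ne_zero.2 hQ0
  have hS₀ : S₀.Finite := by
    refine (Q.leadingCoeff.roots.toFinset.finite_toSet).subset ?_
    intro t ht
    simp only [Finset.mem_coe, Multiset.mem_toFinset]
    exact (Polynomial.mem_roots hlQ).2 ht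
  let qp : ℂ → Polynomial ℂ := fun t => Q.map (Polynomial.evalRingHom t)
  have hqeval : ∀ t x, (qp t).eval x = Q.evalEval t x := fun t x =>
    Polynomial.map_evalRingHom_eval t x Q
  have hqdeg : ∀ t ∉ S₀, (qp t).natDegree = d := fun t ht =>
    Polynomial.natDegree_map_of_leadingCoeff_ne_zero _ ht
  have hqne : ∀ t ∉ S₀, qp t ≠ 0 := by
    intro t ht h
    apply ht
    have : (qp t).coeff d = 0 := by rw [h]; simp
    simp only [qp, Polynomial.coeff_map, Polynomial.coe_evalRingHom] at this
    exact this
  -- the family of fibres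
  let gp : ℂ × ℂ → Polynomial ℂ := fun w =>
    G.map (Polynomial.evalRingHom w.1) - Polynomial.C w.2
  have hlcG : G.leadingCoeff = Polynomial.C a := by rw [Polynomial.leadingCoeff, hdeg, hlc]
  have hgdeg : ∀ w, (gp w).natDegree = n := by
    intro w
    simp only [gp]
    rw [Polynomial.natDegree_sub_C, Polynomial.natDegree_map_of_leadingCoeff_ne_zero, hdeg]
    rw [hlcG]; simpa using ha
  have hgne : ∀ w, gp w ≠ 0 := by
    intro w h
    have := hgdeg w
    rw [h, Polynomial.natDegree_zero] at this
    omega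
  have hgeval : ∀ w y, (gp w).eval y = 0 ↔ G.evalEval w.1 y = w.2 := by
    intro w y
    simp only [gp]
    rw [Polynomial.eval_sub, Polynomial.map_evalRingHom_eval, Polynomial.eval_C, sub_eq_zero]
  have hZset : (fun w : ℂ × ℂ => {y | (gp w).eval y = 0}) =
      fun w : ℂ × ℂ => {y | G.evalEval w.1 y = w.2} := by
    ext1 w
    ext1 y
    exact hgeval w y
  have hZ : RootFam (fun w : ℂ × ℂ => {y | G.evalEval w.1 y = w.2}) := by
    rw [← hZset]
    refine rootFam_of_poly gp n hgdeg hgne ?_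
    intro i
    simp only [gp, Polynomial.coeff_sub, Polynomial.coeff_map, Polynomial.coe_evalRingHom,
      Polynomial.coeff_C]
    refine ((G.coeff i).continuous.comp continuous_fst).sub ?_
    split_ifs
    · exact continuous_snd
    · exact continuous_const
  have hGcont : Continuous (fun p : ℂ × ℂ => G.evalEval p.1 p.2) := by
    have : (fun p : ℂ × ℂ => G.evalEval p.1 p.2) =
        fun p => ∑ i ∈ Finset.range (n + 1), (G.coeff i).eval p.1 * p.2 ^ i := by
      ext p
      rw [Polynomial.evalEval, Polynomial.eval_eq_sum_range (p := G), hdeg, Polynomial.eval_finsetSum]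
      simp
    rw [this]
    apply continuous_finsetSum
    intro i _
    exact ((G.coeff i).continuous.comp continuous_fst).mul (continuous_snd.pow i)
  have hZle : ∀ x t, {y | G.evalEval x y = t}.ncard ≤ n := by
    intro x t
    have h1 : {y | G.evalEval x y = t} ⊆ ((gp (x, t)).roots.toFinset : Set ℂ) := by
      intro y hy
      simp only [Finset.mem_coe, Multiset.mem_toFinset]
      exact (Polynomial.mem_roots (hgne _)).2 ((hgeval (x, t) y).2 hy)
    refine (Set.ncard_le_ncard h1 (Finset.finite_toSet _)).trans ?_
    rw [Set.ncard_coe_finset, ← hgdeg (x, t)]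
    exact (Multiset.toFinset_card_le _).trans (Polynomial.card_roots' _)
  have hsimple : ∀ x t, Q.evalEval t x ≠ 0 → {y | G.evalEval x y = t}.ncard = n := by
    intro x t hxt
    have h1 := ncard_roots_of_simple (gp (x, t)) (hgne _) (by
      intro y hy hdy
      have hy := (hgeval _ _).1 hy
      simp only at hy
      have hd : G.derivative.evalEval x y = 0 := by
        simp only [gp] at hdy
        rw [Polynomial.derivative_sub, Polynomial.derivative_C, sub_zero,
          Polynomial.derivative_map, Polynomial.map_evalRingHom_eval] at hdy
        exact hdy
      have := hQ x y hd
      rw [hy] at this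
      exact hxt this)
    rw [hgdeg] at h1
    rw [← h1]
    exact congrArg Set.ncard (congrFun hZset (x, t)).symm
  -- the critical x-coordinates
  let A : ℂ → Finset ℂ := fun t => (qp t).roots.toFinset
  have hA : ∀ t ∉ S₀, ∀ x, x ∈ A t ↔ Q.evalEval t x = 0 := by
    intro t ht x
    simp only [A, Multiset.mem_toFinset]
    rw [Polynomial.mem_roots (hqne t ht), Polynomial.IsRoot, hqeval]
  have hAcard : ∀ t ∉ S₀, (A t).card ≤ d := by
    intro t ht
    rw [← hqdeg t ht]
    exact (Multiset.toFinset_card_le _).trans (Polynomial.card_roots' _)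
  obtain ⟨FQ, hFQ⟩ := exists_mv Q 0 1
  obtain ⟨FG, hFG⟩ := exists_mv G 1 2
  -- first count
  obtain ⟨S₁, hS₁, k₁, hk₁⟩ : ∃ S : Set ℂ, S.Finite ∧ ∃ k, ∀ t ∉ S, (A t).card = k := by
    have hset : ∀ t ∉ S₀, {p : ℂ × ℂ | Q.evalEval t p.1 = 0 ∧ p.2 = 0} =
        {p : ℂ × ℂ | p.1 ∈ A t ∧ p.2 ∈ ({0} : Set ℂ)} := by
      intro t ht
      ext p
      show (_ ∧ _) ↔ (_ ∧ _)
      rw [hA t ht, Set.mem_singleton_iff]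
    have hf := fun t => ncard_fibered (A t) (fun _ => {0}) (fun _ => Set.finite_singleton _)
    have hcardA : ∀ t ∉ S₀, {p : ℂ × ℂ | Q.evalEval t p.1 = 0 ∧ p.2 = 0}.ncard = (A t).card := by
      intro t ht
      rw [hset t ht, (hf t).2]; simp
    obtain ⟨S, hS, k, hk⟩ := count_constant FQ (MvPolynomial.X 2)
      (fun t => {p : ℂ × ℂ | Q.evalEval t p.1 = 0 ∧ p.2 = 0})
      (fun t p => by
        rw [hFQ, MvPolynomial.eval_X]
        exact Iff.rfl) S₀ hS₀ d
      (fun t ht => by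
        rw [hset t ht]; exact (hf t).1)
      (fun t ht => by
        rw [hcardA t ht]; exact hAcard t ht)
    refine ⟨S ∪ S₀, hS.union hS₀, k, fun t ht => ?_⟩
    rw [← hcardA t (fun h => ht (Or.inr h))]
    exact hk t (fun h => ht (Or.inl h))
  -- second count
  obtain ⟨S₂, hS₂, k₂, hk₂⟩ : ∃ S : Set ℂ, S.Finite ∧ ∃ k, ∀ t ∉ S,
      ∑ x ∈ A t, {y | G.evalEval x y = t}.ncard = k := by
    have hset : ∀ t ∉ S₀, {p : ℂ × ℂ | Q.evalEval t p.1 = 0 ∧ G.evalEval p.1 p.2 = t} =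
        {p : ℂ × ℂ | p.1 ∈ A t ∧ p.2 ∈ {y | G.evalEval p.1 y = t}} := by
      intro t ht
      ext p
      show (_ ∧ _) ↔ (_ ∧ _)
      rw [hA t ht]
      exact Iff.rfl
    have hf := fun t => ncard_fibered (A t) (fun x => {y | G.evalEval x y = t})
      (fun x => hZ.fin (x, t))
    have hcardA : ∀ t ∉ S₀, {p : ℂ × ℂ | Q.evalEval t p.1 = 0 ∧ G.evalEval p.1 p.2 = t}.ncard =
        ∑ x ∈ A t, {y | G.evalEval x y = t}.ncard := by
      intro t ht
      rw [hset t ht, (hf t).2]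
    obtain ⟨S, hS, k, hk⟩ := count_constant FQ (FG - MvPolynomial.X 0)
      (fun t => {p : ℂ × ℂ | Q.evalEval t p.1 = 0 ∧ G.evalEval p.1 p.2 = t})
      (fun t p => by
        rw [hFQ, map_sub, MvPolynomial.eval_X, hFG, sub_eq_zero]
        exact Iff.rfl) S₀ hS₀ (d * n)
      (fun t ht => by
        rw [hset t ht]; exact (hf t).1)
      (fun t ht => by
        rw [hcardA t ht]
        refine (Finset.sum_le_card_nsmul _ _ n (fun x _ => hZle x t)).trans ?_
        rw [smul_eq_mul]
        exact Nat.mul_le_mul_right _ (hAcard t ht))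
    refine ⟨S ∪ S₀, hS.union hS₀, k, fun t ht => ?_⟩
    rw [← hcardA t (fun h => ht (Or.inr h))]
    exact hk t (fun h => ht (Or.inl h))
  -- the exceptional set
  let S : Set ℂ := S₀ ∪ S₁ ∪ S₂
  have hSfin : S.Finite := (hS₀.union hS₁).union hS₂
  refine ⟨S, hSfin, fun t₀ ht₀ => ?_⟩
  have hSo : IsOpen Sᶜ := hSfin.isClosed.isOpen_compl
  have hn0 : ∀ t ∈ Sᶜ, t ∉ S₀ := fun t ht h => ht (Or.inl (Or.inl h))
  have hn1 : ∀ t ∈ Sᶜ, t ∉ S₁ := fun t ht h => ht (Or.inl (Or.inr h))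
  have hn2 : ∀ t ∈ Sᶜ, t ∉ S₂ := fun t ht h => ht (Or.inr h)
  let W := {t : ℂ // t ∈ Sᶜ}
  have hX : RootFam (fun w : W => {x | (qp w.1).eval x = 0}) := by
    refine rootFam_of_poly (fun w : W => qp w.1) d (fun w => hqdeg _ (hn0 _ w.2))
      (fun w => hqne _ (hn0 _ w.2)) ?_
    intro i
    simp only [qp, Polynomial.coeff_map, Polynomial.coe_evalRingHom]
    exact (Q.coeff i).continuous.comp continuous_subtype_val
  have hXA : ∀ w : W, {x | (qp w.1).eval x = 0} = (A w.1 : Set ℂ) := by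
    intro w
    ext x
    rw [Finset.mem_coe, hA _ (hn0 _ w.2), ← hqeval]
    exact Iff.rfl
  simp only [hXA] at hX
  let w₀ : W := ⟨t₀, ht₀⟩
  obtain ⟨V, hVo, hV0, ε, hε, y, hy0, hyc, hyi, hyimg, -⟩ := hX.sheets w₀
    (Eventually.of_forall fun w => by
      rw [Set.ncard_coe_finset, Set.ncard_coe_finset, hk₁ _ (hn1 _ w.2), hk₁ _ (hn1 _ w₀.2)])
  let r : ℂ → W := fun t => if h : t ∈ Sᶜ then ⟨t, h⟩ else w₀
  have hr : ∀ w : W, r w.1 = w := fun w => by simp only [r]; rw [dif_pos w.2]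
  have hrt : ∀ t ∈ Sᶜ, (r t).1 = t := fun t ht => by simp only [r]; rw [dif_pos ht]
  have hrc : ContinuousOn r Sᶜ := by
    rw [IsInducing.subtypeVal.continuousOn_iff]
    exact continuousOn_id.congr hrt
  let V₁ : Set ℂ := Subtype.val '' V
  have hV₁o : IsOpen V₁ := hSo.isOpenMap_subtype_val _ hVo
  have hV₁S : V₁ ⊆ Sᶜ := by rintro _ ⟨w, _, rfl⟩; exact w.2
  have hrV : ∀ t ∈ V₁, r t ∈ V := by
    rintro _ ⟨w, hw, rfl⟩
    rw [hr]; exact hw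
  let ξ : ℂ → ℂ → ℂ := fun b t => y b (r t)
  have hξ0 : ∀ b ∈ A t₀, ξ b t₀ = b := by
    intro b hb
    show y b (r w₀.1) = b
    rw [hr]
    exact hy0 b hb
  have hξc : ∀ b ∈ A t₀, ContinuousOn (ξ b) V₁ := fun b hb =>
    (hyc b hb).comp (hrc.mono hV₁S) hrV
  have hξinj : ∀ t ∈ V₁, Set.InjOn (fun b => ξ b t) (A t₀ : Set ℂ) := fun t ht =>
    hyi _ (hrV t ht)
  have hξimg : ∀ t ∈ V₁, (A t₀).image (fun b => ξ b t) = A t := by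
    intro t ht
    have := hyimg _ (hrV t ht)
    rw [hrt t (hV₁S ht)] at this
    apply Finset.coe_injective
    rw [Finset.coe_image]
    exact this
  have ht₁ : t₀ ∈ V₁ := ⟨w₀, hV0, rfl⟩
  have hlow : ∀ᶠ t in 𝓝 t₀, ∀ b ∈ A t₀,
      {z | G.evalEval b z = t₀}.ncard ≤ {z | G.evalEval (ξ b t) z = t}.ncard := by
    rw [Filter.eventually_all_finset]
    intro b hb
    have h1 := hZ.ncard_le (b, t₀)
    have h2 : ContinuousAt (fun t => (ξ b t, t)) t₀ :=
      ((hξc b hb).continuousAt (hV₁o.mem_nhds ht₁)).prodMk continuousAt_id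
    have h3 : Tendsto (fun t => (ξ b t, t)) (𝓝 t₀) (𝓝 (b, t₀)) := by
      have := h2.tendsto
      rwa [hξ0 b hb] at this
    exact h3.eventually h1
  obtain ⟨V₂, hV₂, hV₂o, ht₂⟩ := eventually_nhds_iff.1 hlow
  obtain ⟨V', hV'o, hV't, hV's, T, hT, φ, hφ⟩ := topo_core (fun x z => G.evalEval x z) hGcont hZ n
    (A t₀) t₀ (V₁ ∩ V₂)
    (hV₁o.inter hV₂o) ⟨ht₁, ht₂⟩ ξ hξ0 (fun b hb => (hξc b hb).mono Set.inter_subset_left)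
    (by
      intro t ht x hx
      apply hsimple
      rw [Ne, ← hA t (hn0 t (hV₁S ht.1)), ← hξimg t ht.1, Finset.mem_image]
      rintro ⟨b, hb, rfl⟩
      exact hx b hb rfl)
    (by
      intro t ht
      have hsum : ∑ b ∈ A t₀, {z | G.evalEval b z = t₀}.ncard =
          ∑ b ∈ A t₀, {z | G.evalEval (ξ b t) z = t}.ncard := by
        rw [hk₂ t₀ (hn2 _ ht₀), ← hk₂ t (hn2 _ (hV₁S ht.1)), ← hξimg t ht.1,
          Finset.sum_image (hξinj t ht.1)]
      have := (Finset.sum_eq_sum_iff_of_le (hV₂ t ht.2)).1 hsum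
      intro b hb
      exact (this b hb).symm)
  exact ⟨V', hV'o, hV't, hV's.trans (Set.inter_subset_left.trans hV₁S), T, hT, φ, hφ⟩

end Helpers

/-- A polynomial map `g : ℂ² → ℂ` is a locally trivial fibration away from a finite
set `Σ` of atypical values. -/
theorem polynomial_fibration_off_finite_set (g : MvPolynomial (Fin 2) ℂ) :
    ∃ S : Finset ℂ,
      IsLocallyTrivialFibration
        (fun x : {x : Fin 2 → ℂ // eval x g ∉ S} =>
          (⟨eval x.1 g, x.2⟩ : {ρ : ℂ // ρ ∉ S})) := by
  have hgc : Continuous (fun x : Fin 2 → ℂ => eval x g) := MvPolynomial.continuous_eval g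
  have hcont : ∀ S : Finset ℂ, Continuous (fun x : {x : Fin 2 → ℂ // eval x g ∉ S} =>
          (⟨eval x.1 g, x.2⟩ : {ρ : ℂ // ρ ∉ S})) := fun S =>
    (hgc.comp continuous_subtype_val).subtype_mk _
  by_cases hg : ∀ c, g ≠ MvPolynomial.C c
  · obtain ⟨N, G, n, a, ha, hn, hdeg, hlc, hev⟩ := exists_monic_form g hg
    obtain ⟨S, hS, hmain⟩ := exists_bif G n a ha hn hdeg hlc
    refine ⟨hS.toFinset, hcont _, ?_⟩
    rintro ⟨t₀, ht₀⟩
    obtain ⟨V, hVo, ht₀V, hVS, T, hT, φ, hφ⟩ := hmain t₀ (by simpa using ht₀)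
    refine ⟨Subtype.val ⁻¹' V, hVo.preimage continuous_subtype_val, ht₀V, T, hT, ?_⟩
    have hVS' : ∀ t ∈ V, t ∉ hS.toFinset := fun t ht => by simpa using hVS ht
    have hinv : ∀ x : Fin 2 → ℂ, G.evalEval (x 0 - x 1 ^ N) (x 1) = eval x g := by
      intro x
      rw [hev]
      congr 2
      ext i
      fin_cases i <;> simp
    let e1 : (((fun x : {x : Fin 2 → ℂ // eval x g ∉ hS.toFinset} =>
          (⟨eval x.1 g, x.2⟩ : {ρ : ℂ // ρ ∉ hS.toFinset})) ⁻¹' (Subtype.val ⁻¹' V) : Set _)) ≃ₜ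
        {p : ℂ × ℂ // G.evalEval p.1 p.2 ∈ V} :=
      { toFun := fun x => ⟨(x.1.1 0 - x.1.1 1 ^ N, x.1.1 1), by
          rw [hinv]; exact x.2⟩
        invFun := fun p => ⟨⟨![p.1.1 + p.1.2 ^ N, p.1.2], by
          rw [← hev]; exact hVS' _ p.2⟩, by
          show eval ![p.1.1 + p.1.2 ^ N, p.1.2] g ∈ V
          rw [← hev]; exact p.2⟩
        left_inv := by
          intro x
          apply Subtype.ext
          apply Subtype.ext
          ext i
          fin_cases i <;> simp
        right_inv := by
          intro p
          apply Subtype.ext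
          simp
        continuous_toFun := by
          apply Continuous.subtype_mk
          have hi : ∀ i : Fin 2, Continuous (fun x : (((fun x : {x : Fin 2 → ℂ //
              eval x g ∉ hS.toFinset} => (⟨eval x.1 g, x.2⟩ : {ρ : ℂ // ρ ∉ hS.toFinset})) ⁻¹'
              (Subtype.val ⁻¹' V) : Set _)) => x.1.1 i) := fun i =>
            (continuous_apply i).comp (continuous_subtype_val.comp continuous_subtype_val)
          exact ((hi 0).sub ((hi 1).pow N)).prodMk (hi 1)
        continuous_invFun := by
          apply Continuous.subtype_mk
          apply Continuous.subtype_mk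
          refine continuous_pi fun i => ?_
          fin_cases i
          · simp only [Fin.zero_eta, Matrix.cons_val_zero]
            fun_prop
          · simp only [Fin.mk_one, Matrix.cons_val_one]
            fun_prop }
    let e2 : V ≃ₜ (Subtype.val ⁻¹' V : Set {ρ : ℂ // ρ ∉ hS.toFinset}) :=
      { toFun := fun t => ⟨⟨t.1, hVS' _ t.2⟩, t.2⟩
        invFun := fun t => ⟨t.1.1, t.2⟩
        left_inv := fun _ => rfl
        right_inv := fun _ => rfl
        continuous_toFun := by fun_prop
        continuous_invFun := by fun_prop }
    refine ⟨(e1.trans φ).trans (e2.prodCongr (Homeomorph.refl T)), ?_⟩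
    intro e
    apply Subtype.ext
    show ((φ (e1 e)).1 : ℂ) = eval e.1.1 g
    rw [hφ]
    exact hinv _
  · push Not at hg
    obtain ⟨c, rfl⟩ := hg
    refine ⟨{c}, hcont _, fun b => ?_⟩
    refine ⟨Set.univ, isOpen_univ, Set.mem_univ _, Empty, inferInstance, ?_⟩
    have hemp : ∀ x : {x : Fin 2 → ℂ // eval x (MvPolynomial.C c) ∉ ({c} : Finset ℂ)}, False := by
      rintro ⟨x, hx⟩
      simp at hx
    refine ⟨{ toFun := fun x => (hemp x.1).elim
              invFun := fun q => q.2.elim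
              left_inv := fun x => (hemp x.1).elim
              right_inv := fun q => q.2.elim
              continuous_toFun := continuous_iff_continuousAt.2 fun x => (hemp x.1).elim
              continuous_invFun := continuous_iff_continuousAt.2 fun q => q.2.elim },
      fun e => (hemp e.1).elim⟩
end

section
/- Let f and g be polynomials in two complex variables that are algebraically independent over ℂ. Then there exists a finite set Σ ⊂ ℂ such that for every c ∈ ℂ ∖ Σ there exists a finite set Σ_c ⊂ ℂ such that for every ρ ∈ ℂ ∖ Σ_c, the fiber g⁻¹(ρ) intersects every connected component of the subspace f⁻¹(c) of ℂ²; that is, for every x ∈ ℂ² with f(x) = c there exists y in the connected component of x in the subspace f⁻¹(c) with g(y) = ρ. -/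
open MvPolynomial

lemma fmc_isAlg (a b : MvPolynomial (Fin 2) ℂ) (h : AlgebraicIndependent ℂ ![a, b]) :
    Algebra.IsAlgebraic (Algebra.adjoin ℂ (Set.range ![a, b])) (MvPolynomial (Fin 2) ℂ) := by
  have : IsTranscendenceBasis ℂ ![a, b] := by
    apply h.isTranscendenceBasis_of_trdeg_le_of_finite
    rw [MvPolynomial.trdeg_of_isDomain]
    simp
  exact this.isAlgebraic

lemma fmc_dvd (a b s : MvPolynomial (Fin 2) ℂ) (h : AlgebraicIndependent ℂ ![a, b]) (hs : s ≠ 0) :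
    ∃ m : MvPolynomial (Fin 2) ℂ, m ≠ 0 ∧ s ∣ aeval ![a, b] m := by
  have := fmc_isAlg a b h
  obtain ⟨r, hr, hd⟩ := (Algebra.IsAlgebraic.isAlgebraic (R := Algebra.adjoin ℂ (Set.range ![a, b])) s).exists_nonzero_dvd
    (mem_nonZeroDivisors_of_ne_zero hs)
  obtain ⟨r, hr'⟩ := r
  have h2 := hr'
  rw [Algebra.adjoin_range_eq_range_aeval] at h2
  obtain ⟨m, hm⟩ := h2
  refine ⟨m, ?_, ?_⟩
  · rintro rfl
    apply hr
    ext1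
    simpa using hm.symm
  · change s ∣ r at hd
    have hm' : aeval ![a, b] m = r := hm
    rwa [hm']

lemma fmc_integral (a b s : MvPolynomial (Fin 2) ℂ) (h : AlgebraicIndependent ℂ ![a, b]) :
    ∃ l : MvPolynomial (Fin 2) ℂ, l ≠ 0 ∧ ∃ (n : ℕ) (p : ℕ → MvPolynomial (Fin 2) ℂ),
      (aeval ![a, b] l * s) ^ n + ∑ k ∈ Finset.range n, aeval ![a, b] (p k) * (aeval ![a, b] l * s) ^ k = 0 := by
  have := fmc_isAlg a b h
  obtain ⟨⟨r, hr'⟩, hr, P, hP, hP0⟩ := (Algebra.IsAlgebraic.isAlgebraic (R := Algebra.adjoin ℂ (Set.range ![a, b])) s).exists_integral_multiple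
  have hx : ∀ r : Algebra.adjoin ℂ (Set.range ![a, b]), ∃ m : MvPolynomial (Fin 2) ℂ, aeval ![a, b] m = (r : MvPolynomial (Fin 2) ℂ) := by
    rintro ⟨r, h2⟩
    rw [Algebra.adjoin_range_eq_range_aeval] at h2
    obtain ⟨m, hm⟩ := h2
    exact ⟨m, hm⟩
  choose F hF using hx
  refine ⟨F ⟨r, hr'⟩, ?_, P.natDegree, fun k => F (P.coeff k), ?_⟩
  · intro h0
    apply hr
    ext1
    rw [← hF, h0]; simp
  · simp only [hF]
    rw [Polynomial.eval₂_eq_sum_range, Finset.sum_range_succ, hP.coeff_natDegree] at hP0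
    rw [add_comm]
    simpa [Subalgebra.smul_def] using hP0

lemma fmc_deriv (a b s : MvPolynomial (Fin 2) ℂ) (h : AlgebraicIndependent ℂ ![a, b])
    (D : Derivation ℂ (MvPolynomial (Fin 2) ℂ) (MvPolynomial (Fin 2) ℂ)) (ha : D a = 0) (hb : D b = 0) :
    D s = 0 := by
  have := fmc_isAlg a b h
  set A := Algebra.adjoin ℂ (Set.range ![a, b]) with hA
  have hk : ∀ r : A, D (r : MvPolynomial (Fin 2) ℂ) = 0 := by
    rintro ⟨r, hr⟩
    refine Algebra.adjoin_induction (p := fun x _ => D x = 0) ?_ ?_ ?_ ?_ hr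
    · rintro x ⟨i, rfl⟩
      fin_cases i <;> simpa
    · intro r; simp
    · intro x y _ _ h1 h2; simp [h1, h2]
    · intro x y _ _ h1 h2; simp [h1, h2]
  let D' : Derivation A (MvPolynomial (Fin 2) ℂ) (MvPolynomial (Fin 2) ℂ) :=
    { toFun := D
      map_add' := by simp
      map_smul' := by
        intro m x
        simp [Subalgebra.smul_def, hk]
      map_one_eq_zero' := by simp
      leibniz' := by intro x y; simp }
  have hex : ∃ n : ℕ, ∃ P : Polynomial A, P ≠ 0 ∧ Polynomial.aeval s P = 0 ∧ P.natDegree = n := by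
    obtain ⟨P, h1, h2⟩ := (Algebra.IsAlgebraic.isAlgebraic (R := A) s)
    exact ⟨_, P, h1, h2, rfl⟩
  classical
  obtain ⟨P, hP, hP0, hn⟩ := Nat.find_spec hex
  have hmin := fun m hm => Nat.find_min hex (m := m) hm
  rw [← hn] at hmin
  have hd : P.natDegree ≠ 0 := by
    intro h0
    rw [Polynomial.eq_C_of_natDegree_eq_zero h0] at hP0 hP
    simp at hP0 hP
    exact hP hP0
  have h1 : D' (Polynomial.aeval s P) = Polynomial.aeval s (Polynomial.derivative P) • D' s := by
    exact Derivation.map_aeval _ _ _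
  rw [hP0, map_zero] at h1
  have h2 := h1.symm
  rw [smul_eq_mul, mul_eq_zero] at h2
  rcases h2 with h2 | h2
  · exfalso
    refine hmin (Polynomial.derivative P).natDegree (Polynomial.natDegree_derivative_lt hd) ⟨_, ?_, h2, rfl⟩
    intro h3
    exact hd (Polynomial.derivative_eq_zero.1 h3)
  · exact h2

noncomputable def fmcJ (f g : MvPolynomial (Fin 2) ℂ) : MvPolynomial (Fin 2) ℂ :=
  pderiv 0 f * pderiv 1 g - pderiv 1 f * pderiv 0 g

lemma fmc_J_ne (f g : MvPolynomial (Fin 2) ℂ) (h : AlgebraicIndependent ℂ ![f, g]) : fmcJ f g ≠ 0 := by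
  intro hJ
  unfold fmcJ at hJ
  have key : ∀ e : MvPolynomial (Fin 2) ℂ, pderiv 0 e * pderiv 1 f = pderiv 1 e * pderiv 0 f := by
    intro e
    have := fmc_deriv f g e h (pderiv 1 f • pderiv 0 - pderiv 0 f • pderiv 1)
      (by simp; ring) (by simp; linear_combination -hJ)
    simp at this
    linear_combination this
  have key2 : ∀ e : MvPolynomial (Fin 2) ℂ, pderiv 0 e * pderiv 1 g = pderiv 1 e * pderiv 0 g := by
    intro e
    have := fmc_deriv f g e h (pderiv 1 g • pderiv 0 - pderiv 0 g • pderiv 1)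
      (by simp; linear_combination hJ) (by simp; ring)
    simp at this
    linear_combination this
  have h1 := key (X 1)
  have h2 := key2 (X 1)
  simp [pderiv_X] at h1 h2
  have := fmc_deriv f g (X 0) h (pderiv 0) h1.symm h2.symm
  simp at this

lemma fmc_exchange (f g : MvPolynomial (Fin 2) ℂ) (h : AlgebraicIndependent ℂ ![f, g]) :
    ∃ i, AlgebraicIndependent ℂ ![f, X i] := by
  have hf : AlgebraicIndepOn ℂ id ({f} : Set (MvPolynomial (Fin 2) ℂ)) := by
    have h0 := h.transcendental 0
    simp only [Matrix.cons_val_zero] at h0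
    have := (algebraicIndependent_singleton_iff (R := ℂ)
      (x := fun y : ({f} : Set (MvPolynomial (Fin 2) ℂ)) => (y : MvPolynomial (Fin 2) ℂ)) ⟨f, rfl⟩).2 h0
    exact this
  have htop : Algebra.adjoin ℂ (insert f (Set.range (X : Fin 2 → MvPolynomial (Fin 2) ℂ))) = ⊤ := by
    rw [eq_top_iff, ← MvPolynomial.adjoin_range_X]
    exact Algebra.adjoin_mono (Set.subset_insert _ _)
  have halg : Algebra.IsAlgebraic
      (Algebra.adjoin ℂ (insert f (Set.range (X : Fin 2 → MvPolynomial (Fin 2) ℂ))))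
      (MvPolynomial (Fin 2) ℂ) := by
    constructor
    intro x
    have hx : x ∈ Algebra.adjoin ℂ (insert f (Set.range (X : Fin 2 → MvPolynomial (Fin 2) ℂ))) := by
      rw [htop]; trivial
    exact isAlgebraic_algebraMap (⟨x, hx⟩ :
      Algebra.adjoin ℂ (insert f (Set.range (X : Fin 2 → MvPolynomial (Fin 2) ℂ))))
  obtain ⟨u, hsu, hut, hu⟩ := exists_isTranscendenceBasis_between (R := ℂ) {f}
    (insert f (Set.range (X : Fin 2 → MvPolynomial (Fin 2) ℂ))) (by simp) hf
  have hfu : f ∈ u := hsu rfl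
  have hne : u ≠ {f} := by
    rintro rfl
    have := hu.cardinalMk_eq_trdeg
    rw [MvPolynomial.trdeg_of_isDomain] at this
    simp at this
  have hex : ∃ y ∈ u, y ≠ f := by
    by_contra hcon
    push Not at hcon
    exact hne (Set.Subset.antisymm (fun y hy => hcon y hy) hsu)
  obtain ⟨y, hy, hyf⟩ := hex
  rcases hut hy with hy' | ⟨i, rfl⟩
  · exact absurd hy' hyf
  · refine ⟨i, ?_⟩
    have := hu.1.comp ![⟨f, hfu⟩, ⟨X i, hy⟩] (by
      intro a b hab
      fin_cases a <;> fin_cases b <;> simp_all [eq_comm])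
    convert this using 1
    ext1 k
    fin_cases k <;> rfl

lemma fmc_finite (m : MvPolynomial (Fin 2) ℂ) (v : Fin 2 → Polynomial ℂ) (t : ℂ)
    (ht : eval (fun k => (v k).eval t) m ≠ 0) :
    {c : ℂ | eval (fun k => (v k).eval c) m = 0}.Finite := by
  have he : ∀ c, (aeval v m).eval c = eval (fun k => (v k).eval c) m := by
    intro c
    have : ((Polynomial.aeval c : Polynomial ℂ →ₐ[ℂ] ℂ).comp (aeval v)) =
        aeval (fun k => (v k).eval c) := by
      ext k; simp
    have h2 := DFunLike.congr_fun this m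
    simpa [MvPolynomial.aeval_eq_eval] using h2
  have hne : aeval v m ≠ 0 := by
    intro h0
    apply ht
    rw [← he, h0]; simp
  refine ((aeval v m).rootSet_finite ℂ).subset ?_
  intro c hc
  rw [Polynomial.mem_rootSet]
  exact ⟨hne, by simpa [he] using hc⟩

lemma fmc_finite1 (m : MvPolynomial (Fin 2) ℂ) (hm : m ≠ 0) :
    {c : ℂ | ∀ t, eval ![c, t] m = 0}.Finite := by
  have : ∃ z, eval z m ≠ 0 := by
    by_contra hcon
    push Not at hcon
    exact hm (MvPolynomial.funext fun z => by simp [hcon])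
  obtain ⟨z, hz⟩ := this
  have e : ∀ c, (fun k => Polynomial.eval c ((![Polynomial.X, Polynomial.C (z 1)] : Fin 2 → Polynomial ℂ) k)) = ![c, z 1] := by
    intro c; ext k; fin_cases k <;> simp
  have e0 : ![z 0, z 1] = z := by ext k; fin_cases k <;> simp
  have := fmc_finite m ![Polynomial.X, Polynomial.C (z 1)] (z 0) (by rw [e, e0]; exact hz)
  simp only [e] at this
  exact this.subset fun c hc => hc _

lemma fmc_finite2 (m : MvPolynomial (Fin 2) ℂ) (c : ℂ) (h : ¬ ∀ t, eval ![c, t] m = 0) :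
    {t : ℂ | eval ![c, t] m = 0}.Finite := by
  push Not at h
  obtain ⟨z, hz⟩ := h
  have e : ∀ t, (fun k => Polynomial.eval t ((![Polynomial.C c, Polynomial.X] : Fin 2 → Polynomial ℂ) k)) = ![c, t] := by
    intro c; ext k; fin_cases k <;> simp
  have := fmc_finite m ![Polynomial.C c, Polynomial.X] z (by rw [e]; exact hz)
  simpa only [e] using this

open Topology Filter

lemma fmc_hasStrict (p : MvPolynomial (Fin 2) ℂ) (z : Fin 2 → ℂ) :
    HasStrictFDerivAt (fun w : Fin 2 → ℂ => eval w p)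
      (eval z (pderiv 0 p) • (ContinuousLinearMap.proj 0 : (Fin 2 → ℂ) →L[ℂ] ℂ)
        + eval z (pderiv 1 p) • (ContinuousLinearMap.proj 1 : (Fin 2 → ℂ) →L[ℂ] ℂ)) z := by
  induction p using MvPolynomial.induction_on with
  | C a =>
    simp only [eval_C]
    refine (hasStrictFDerivAt_const (𝕜 := ℂ) a z).congr_fderiv ?_
    ext v; simp
  | add p q hp hq =>
    simp only [map_add]
    refine (hp.add hq).congr_fderiv ?_
    ext v
    simp only [add_apply, smul_apply, smul_eq_mul]
    ring
  | mul_X p n hp =>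
    simp only [map_mul, eval_X]
    have hX : HasStrictFDerivAt (fun w : Fin 2 → ℂ => w n)
      (ContinuousLinearMap.proj n : (Fin 2 → ℂ) →L[ℂ] ℂ) z :=
      (ContinuousLinearMap.proj n : (Fin 2 → ℂ) →L[ℂ] ℂ).hasStrictFDerivAt
    refine (hp.mul hX).congr_fderiv ?_
    ext v
    simp only [add_apply,
      smul_apply, smul_eq_mul, Derivation.leibniz, map_add, map_mul, eval_X,
      ContinuousLinearMap.proj_apply]
    fin_cases n <;> simp [pderiv_X] <;> ring

lemma fmc_local_open (f g : MvPolynomial (Fin 2) ℂ) (c : ℂ) (z : {y : Fin 2 → ℂ // eval y f = c})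
    (hJ : eval (z : Fin 2 → ℂ) (fmcJ f g) ≠ 0) :
    ∀ᶠ ρ in 𝓝 (eval (z : Fin 2 → ℂ) g), ∃ y ∈ connectedComponent z,
      eval (y : Fin 2 → ℂ) g = ρ := by
  obtain ⟨z, hz⟩ := z
  simp only at hJ ⊢
  let F : (Fin 2 → ℂ) → (Fin 2 → ℂ) := fun w => ![eval w f, eval w g]
  let L : (Fin 2 → ℂ) →L[ℂ] (Fin 2 → ℂ) := ContinuousLinearMap.pi
    ![eval z (pderiv 0 f) • (ContinuousLinearMap.proj 0 : (Fin 2 → ℂ) →L[ℂ] ℂ)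
        + eval z (pderiv 1 f) • (ContinuousLinearMap.proj 1 : (Fin 2 → ℂ) →L[ℂ] ℂ),
      eval z (pderiv 0 g) • (ContinuousLinearMap.proj 0 : (Fin 2 → ℂ) →L[ℂ] ℂ)
        + eval z (pderiv 1 g) • (ContinuousLinearMap.proj 1 : (Fin 2 → ℂ) →L[ℂ] ℂ)]
  have hF : HasStrictFDerivAt F L z := by
    rw [hasStrictFDerivAt_pi']
    intro i
    fin_cases i
    · exact fmc_hasStrict f z
    · exact fmc_hasStrict g z
  have hinj : Function.Injective (L : (Fin 2 → ℂ) →ₗ[ℂ] (Fin 2 → ℂ)) := by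
    rw [injective_iff_map_eq_zero]
    intro v hv
    have h0 := congrFun hv 0
    have h1 := congrFun hv 1
    simp [L] at h0 h1
    simp [fmcJ] at hJ
    ext i
    fin_cases i
    · apply mul_left_cancel₀ hJ
      simp only [Fin.zero_eta, Fin.mk_one, Pi.zero_apply, mul_zero]
      linear_combination eval z (pderiv 1 g) * h0 - eval z (pderiv 1 f) * h1
    · apply mul_left_cancel₀ hJ
      simp only [Fin.zero_eta, Fin.mk_one, Pi.zero_apply, mul_zero]
      linear_combination eval z (pderiv 0 f) * h1 - eval z (pderiv 0 g) * h0
  let E : (Fin 2 → ℂ) ≃L[ℂ] (Fin 2 → ℂ) :=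
    (LinearEquiv.ofInjectiveEndo (L : (Fin 2 → ℂ) →ₗ[ℂ] (Fin 2 → ℂ)) hinj).toContinuousLinearEquiv
  have hE : (E : (Fin 2 → ℂ) →L[ℂ] (Fin 2 → ℂ)) = L := by
    ext v i; rfl
  rw [← hE] at hF
  let e := hF.toOpenPartialHomeomorph F
  have hee : ∀ w, e w = F w := fun w => rfl
  have hzs : z ∈ e.source := hF.mem_toOpenPartialHomeomorph_source
  have hzt : ![c, eval z g] ∈ e.target := by
    have := e.map_source hzs
    rw [hee] at this
    simpa [F, hz] using this
  have hcont : Continuous (fun ρ : ℂ => (![c, ρ] : Fin 2 → ℂ)) := by fun_prop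
  have hnh : (fun ρ : ℂ => (![c, ρ] : Fin 2 → ℂ)) ⁻¹' e.target ∈ 𝓝 (eval z g) :=
    (e.open_target.preimage hcont).mem_nhds hzt
  obtain ⟨r, hr, hball⟩ := Metric.mem_nhds_iff.1 hnh
  have hFs : ∀ ρ ∈ Metric.ball (eval z g) r, F (e.symm ![c, ρ]) = ![c, ρ] := by
    intro ρ hρ
    rw [← hee]
    exact e.right_inv (hball hρ)
  have hfs : ∀ ρ ∈ Metric.ball (eval z g) r, eval (e.symm ![c, ρ]) f = c :=
    fun ρ hρ => congrFun (hFs ρ hρ) 0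
  have hgs : ∀ ρ ∈ Metric.ball (eval z g) r, eval (e.symm ![c, ρ]) g = ρ :=
    fun ρ hρ => congrFun (hFs ρ hρ) 1
  let φ : Metric.ball (eval z g) r → {y : Fin 2 → ℂ // eval y f = c} :=
    fun ρ => ⟨e.symm ![c, (ρ : ℂ)], hfs ρ ρ.2⟩
  have hφ : Continuous φ := by
    refine Continuous.subtype_mk ?_ _
    have h1 : ContinuousOn (fun ρ : ℂ => e.symm ![c, ρ]) (Metric.ball (eval z g) r) :=
      e.continuousOn_symm.comp hcont.continuousOn (fun ρ hρ => hball hρ)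
    exact continuousOn_iff_continuous_domRestrict.1 h1
  have hpre : PreconnectedSpace (Metric.ball (eval z g) r) :=
    Subtype.preconnectedSpace (convex_ball (eval z g) r).isPreconnected
  have hrange : IsPreconnected (Set.range φ) := isPreconnected_range hφ
  have hzr : (⟨z, hz⟩ : {y : Fin 2 → ℂ // eval y f = c}) ∈ Set.range φ := by
    refine ⟨⟨eval z g, Metric.mem_ball_self hr⟩, ?_⟩
    apply Subtype.ext
    change e.symm ![c, eval z g] = z
    have : ![c, eval z g] = e z := by rw [hee]; simp [F, hz]
    rw [this]
    exact e.left_inv hzs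
  have hsub := hrange.subset_connectedComponent hzr
  filter_upwards [Metric.ball_mem_nhds _ hr] with ρ hρ
  exact ⟨φ ⟨ρ, hρ⟩, hsub ⟨_, rfl⟩, hgs ρ hρ⟩

/-- local boundedness from an integral equation -/
lemma fmc_bound (b : ℂ) (n : ℕ) (p : ℕ → ℂ) (M : ℝ) (hM : ∀ k < n, ‖p k‖ ≤ M)
    (h : b ^ n + ∑ k ∈ Finset.range n, p k * b ^ k = 0) : ‖b‖ ≤ max 1 (n * M) := by
  by_contra hcon
  push Not at hcon
  obtain ⟨h1, h2⟩ := max_lt_iff.1 hcon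
  rcases n with _ | n
  · simp at h
  have h3 : b ^ (n + 1) = - ∑ k ∈ Finset.range (n + 1), p k * b ^ k := by linear_combination h
  have h4 : ‖b‖ ^ (n + 1) ≤ ∑ k ∈ Finset.range (n + 1), M * ‖b‖ ^ n := by
    rw [← norm_pow, h3, norm_neg]
    refine (norm_sum_le _ _).trans (Finset.sum_le_sum fun k hk => ?_)
    rw [Finset.mem_range] at hk
    rw [norm_mul, norm_pow]
    have := hM k hk
    have h0 := norm_nonneg (p k)
    exact mul_le_mul this (pow_le_pow_right₀ h1.le (by omega)) (by positivity) (h0.trans this)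
  simp only [Finset.sum_const, Finset.card_range, nsmul_eq_mul] at h4
  have h5 : 0 < ‖b‖ ^ n := by positivity
  rw [pow_succ] at h4
  nlinarith

lemma fmc_proper (f g s l : MvPolynomial (Fin 2) ℂ) (n : ℕ) (p : ℕ → MvPolynomial (Fin 2) ℂ)
    (h : (aeval ![f, g] l * s) ^ n
      + ∑ k ∈ Finset.range n, aeval ![f, g] (p k) * (aeval ![f, g] l * s) ^ k = 0)
    (c ρ : ℂ) (hl : eval ![c, ρ] l ≠ 0) :
    ∃ M : ℝ, ∀ᶠ ρ' in 𝓝 ρ, ∀ z : Fin 2 → ℂ, eval z f = c → eval z g = ρ' → ‖eval z s‖ ≤ M := by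
  have he : ∀ (z : Fin 2 → ℂ) (m : MvPolynomial (Fin 2) ℂ),
      eval z (aeval ![f, g] m) = eval ![eval z f, eval z g] m := by
    intro z m
    have : ((aeval z : MvPolynomial (Fin 2) ℂ →ₐ[ℂ] ℂ).comp (aeval ![f, g])) =
        aeval ![eval z f, eval z g] := by
      ext k; fin_cases k <;> simp [MvPolynomial.aeval_eq_eval]
    have h2 := DFunLike.congr_fun this m
    simpa [MvPolynomial.aeval_eq_eval] using h2
  have hc : ∀ m : MvPolynomial (Fin 2) ℂ, Continuous (fun t : ℂ => eval ![c, t] m) := by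
    intro m
    exact (MvPolynomial.continuous_eval m).comp (by fun_prop)
  have hb1 : ∀ᶠ ρ' in 𝓝 ρ, ‖eval ![c, ρ] l‖ / 2 < ‖eval ![c, ρ'] l‖ := by
    have hp : 0 < ‖eval ![c, ρ] l‖ := norm_pos_iff.2 hl
    exact (hc l).norm.continuousAt.eventually_const_lt (by linarith)
  let M0 : ℝ := ∑ k ∈ Finset.range n, (‖eval ![c, ρ] (p k)‖ + 1)
  have hb2 : ∀ᶠ ρ' in 𝓝 ρ, ∀ k ∈ Finset.range n, ‖eval ![c, ρ'] (p k)‖ < ‖eval ![c, ρ] (p k)‖ + 1 := by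
    rw [Filter.eventually_all_finset]
    intro k _
    exact (hc (p k)).norm.continuousAt.eventually_lt_const (by simp)
  refine ⟨max 1 (n * M0) / (‖eval ![c, ρ] l‖ / 2), ?_⟩
  filter_upwards [hb1, hb2] with ρ' h1 h2 z hz1 hz2
  have h3 := congrArg (eval z) h
  simp only [map_add, map_sum, map_mul, map_pow, he, hz1, hz2, map_zero] at h3
  have h4 := fmc_bound _ n (fun k => eval ![c, ρ'] (p k)) M0 (by
    intro k hk
    refine (h2 k (Finset.mem_range.2 hk)).le.trans ?_
    exact Finset.single_le_sum (f := fun k => ‖eval ![c, ρ] (p k)‖ + 1)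
      (fun i _ => by positivity) (Finset.mem_range.2 hk)) h3
  have hp : 0 < ‖eval ![c, ρ] l‖ := norm_pos_iff.2 hl
  rw [le_div_iff₀ (by positivity)]
  rw [norm_mul] at h4
  refine le_trans ?_ h4
  rw [mul_comm]
  exact mul_le_mul_of_nonneg_right h1.le (norm_nonneg _)

lemma fmc_hurwitz (φ : ℂ × ℂ → ℂ) (hφ : Continuous φ) (hd : ∀ x, Differentiable ℂ fun t => φ (x, t))
    (c x0 y0 : ℂ) (h0 : φ (x0, y0) = c) (h1 : ∃ y1, φ (x0, y1) ≠ c) (V : Set (ℂ × ℂ))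
    (hV : V ∈ 𝓝 (x0, y0)) : ∀ᶠ x in 𝓝 x0, ∃ t, (x, t) ∈ V ∧ φ (x, t) = c := by
  have ident : ∀ x y a, (∀ᶠ t in 𝓝 y, φ (x, t) = a) → ∀ t, φ (x, t) = a := by
    intro x y a h t
    have han : AnalyticOnNhd ℂ (fun t => φ (x, t)) Set.univ :=
      (hd x).differentiableOn.analyticOnNhd isOpen_univ
    exact han.eqOn_of_preconnected_of_eventuallyEq (g := fun _ => a) analyticOnNhd_const
      isPreconnected_univ (Set.mem_univ y) h (Set.mem_univ t)
  obtain ⟨V', hV', hV'o, hV'0⟩ := mem_nhds_iff.1 hV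
  have hne : ∀ᶠ t in 𝓝[≠] y0, φ (x0, t) - c ≠ 0 := by
    have han : AnalyticAt ℂ (fun t => φ (x0, t) - c) y0 :=
      ((hd x0).sub_const c).analyticAt y0
    rcases han.eventually_eq_zero_or_eventually_ne_zero with h | h
    · exfalso
      obtain ⟨y1, hy1⟩ := h1
      refine hy1 (ident x0 y0 c ?_ y1)
      filter_upwards [h] with t ht
      exact sub_eq_zero.1 ht
    · exact h
  rw [eventually_nhdsWithin_iff] at hne
  have hVt : ∀ᶠ t in 𝓝 y0, (x0, t) ∈ V' := by
    have : Continuous fun t : ℂ => (x0, t) := by fun_prop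
    exact (hV'o.preimage this).mem_nhds hV'0
  obtain ⟨r, hr, hball⟩ := Metric.nhds_basis_closedBall.eventually_iff.1 (hne.and hVt)
  obtain ⟨w, hw, hmin⟩ := (isCompact_sphere y0 r).exists_isMinOn
    (NormedSpace.sphere_nonempty.2 hr.le)
    (f := fun t => ‖φ (x0, t) - c‖) (by fun_prop)
  set ε := ‖φ (x0, w) - c‖ with hε
  have hsphne : ∀ t ∈ Metric.sphere y0 r, t ≠ y0 := by
    rintro t ht rfl
    simp at ht
    exact hr.ne ht
  have hεpos : 0 < ε := norm_pos_iff.2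
    ((hball (Metric.sphere_subset_closedBall hw)).1 (hsphne w hw))
  have e1 : ∀ᶠ x in 𝓝 x0, ∀ t ∈ Metric.sphere y0 r, ε / 2 < ‖φ (x, t) - φ (x, y0)‖ := by
    refine (isCompact_sphere y0 r).eventually_forall_of_forall_eventually
      (P := fun x t => ε / 2 < ‖φ (x, t) - φ (x, y0)‖) ?_
    intro t ht
    have hc : Continuous fun z : ℂ × ℂ => ‖φ (z.1, z.2) - φ (z.1, y0)‖ := by fun_prop
    refine hc.continuousAt.eventually_const_lt ?_
    have : ε ≤ ‖φ (x0, t) - c‖ := hmin ht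
    simp only [h0]
    linarith
  have e2 : ∀ᶠ x in 𝓝 x0, ∀ t ∈ Metric.closedBall y0 r, (x, t) ∈ V' := by
    refine (isCompact_closedBall y0 r).eventually_forall_of_forall_eventually
      (P := fun x t => (x, t) ∈ V') ?_
    intro t ht
    exact hV'o.mem_nhds (hball ht).2
  have e3 : ∀ᶠ x in 𝓝 x0, ‖c - φ (x, y0)‖ < ε / 2 / 2 := by
    have hc : Continuous fun x : ℂ => ‖c - φ (x, y0)‖ := by fun_prop
    refine hc.continuousAt.eventually_lt_const ?_
    simp only [h0, sub_self, norm_zero]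
    linarith
  filter_upwards [e1, e2, e3] with x h1 h2 h3
  have := DiffContOnCl.ball_subset_image_closedBall (f := fun t => φ (x, t)) (z₀ := y0) (r := r)
    (ε := ε / 2) (hd x).diffContOnCl hr (fun z hz => (h1 z hz).le) (by
      intro hcon
      simp only [not_not] at hcon
      have := ident x y0 _ hcon w
      have h4 := h1 w hw
      rw [this] at h4
      simp at h4
      linarith)
  obtain ⟨t, ht, hte⟩ := this (show c ∈ Metric.ball (φ (x, y0)) (ε / 2 / 2) by
    rw [Metric.mem_ball, dist_eq_norm]; exact h3)
  exact ⟨t, hV' (h2 t ht), hte⟩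

def fmcPt (i : Fin 2) (x t : ℂ) : Fin 2 → ℂ := fun k => if k = i then x else t

lemma fmcPt_self (i : Fin 2) (z : Fin 2 → ℂ) : fmcPt i (z i) (z (i + 1)) = z := by
  ext k
  fin_cases i <;> fin_cases k <;> simp [fmcPt]

lemma fmcPt_apply (i : Fin 2) (x t : ℂ) : fmcPt i x t i = x := by simp [fmcPt]

lemma fmcPt_cont (i : Fin 2) : Continuous fun z : ℂ × ℂ => fmcPt i z.1 z.2 := by
  refine continuous_pi fun k => ?_
  unfold fmcPt
  split_ifs <;> fun_prop

lemma fmcPt_diff (i : Fin 2) (x : ℂ) (f : MvPolynomial (Fin 2) ℂ) :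
    Differentiable ℂ fun t : ℂ => eval (fmcPt i x t) f := by
  have h1 : Differentiable ℂ fun w : Fin 2 → ℂ => eval w f :=
    fun w => (fmc_hasStrict f w).hasFDerivAt.differentiableAt
  refine h1.comp ?_
  rw [differentiable_pi]
  intro k
  unfold fmcPt
  split_ifs <;> fun_prop

lemma fmc_unbounded (f : MvPolynomial (Fin 2) ℂ) (i : Fin 2) (c : ℂ)
    (hs : ∀ x, ∃ t, eval (fmcPt i x t) f ≠ c) (z : {y : Fin 2 → ℂ // eval y f = c}) :
    ¬ ∃ R : ℝ, ∀ y ∈ connectedComponent z, ‖(y : Fin 2 → ℂ)‖ < R := by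
  rintro ⟨R, hR⟩
  have hclosed : IsClosed {y : Fin 2 → ℂ | eval y f = c} :=
    isClosed_eq (MvPolynomial.continuous_eval f) continuous_const
  have hemb : IsClosedEmbedding
      (Subtype.val : {y : Fin 2 → ℂ // eval y f = c} → (Fin 2 → ℂ)) :=
    hclosed.isClosedEmbedding_subtypeVal
  let B : Set {y : Fin 2 → ℂ // eval y f = c} := Subtype.val ⁻¹' Metric.closedBall 0 R
  have hB : IsCompact B := hemb.isCompact_preimage (isCompact_closedBall _ _)
  have : CompactSpace B := isCompact_iff_compactSpace.1 hB
  have hzB : z ∈ B := by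
    have := hR z mem_connectedComponent
    simpa [B] using this.le
  let z0 : B := ⟨z, hzB⟩
  have hcc : ∀ y ∈ connectedComponent z0, ‖((y : {y : Fin 2 → ℂ // eval y f = c}) : Fin 2 → ℂ)‖ < R := by
    intro y hy
    apply hR
    have h1 : IsPreconnected ((Subtype.val : B → _) '' connectedComponent z0) :=
      isPreconnected_connectedComponent.image _ continuous_subtype_val.continuousOn
    exact h1.subset_connectedComponent ⟨z0, mem_connectedComponent, rfl⟩ ⟨y, hy, rfl⟩
  let U : Set B := {y | ‖((y : {y : Fin 2 → ℂ // eval y f = c}) : Fin 2 → ℂ)‖ < R}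
  have hUo : IsOpen U := isOpen_lt (by fun_prop) continuous_const
  have hK : ∃ K : Set B, IsClopen K ∧ z0 ∈ K ∧ K ⊆ U := by
    rw [connectedComponent_eq_iInter_isClopen] at hcc
    have : Nonempty {s : Set B // IsClopen s ∧ z0 ∈ s} := ⟨⟨Set.univ, isClopen_univ, trivial⟩⟩
    have := exists_subset_nhds_of_isCompact' (X := B)
      (V := fun s : {s : Set B // IsClopen s ∧ z0 ∈ s} => (s : Set B)) (U := U)
      (by
        intro s t
        refine ⟨⟨s ∩ t, s.2.1.inter t.2.1, s.2.2, t.2.2⟩, ?_, ?_⟩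
        · exact Set.inter_subset_left
        · exact Set.inter_subset_right)
      (fun s => s.2.1.isClosed.isCompact) (fun s => s.2.1.isClosed)
      (fun y hy => hUo.mem_nhds (hcc y hy))
    obtain ⟨s, hs⟩ := this
    exact ⟨s, s.2.1, s.2.2, hs⟩
  obtain ⟨K, hKc, hzK, hKU⟩ := hK
  -- the compact relatively open piece
  let P : Set ℂ := (fun y : B => ((y : {y : Fin 2 → ℂ // eval y f = c}) : Fin 2 → ℂ) i) '' K
  have hPc : IsCompact P := hKc.isClosed.isCompact.image
    ((continuous_apply i).comp (continuous_subtype_val.comp continuous_subtype_val))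
  have hPo : IsOpen P := by
    rw [isOpen_iff_mem_nhds]
    rintro _ ⟨y, hyK, rfl⟩
    obtain ⟨W1, hW1, hW1K⟩ := isOpen_induced_iff.1 hKc.isOpen
    obtain ⟨W, hW, rfl⟩ := isOpen_induced_iff.1 hW1
    have hyW : ((y : {y : Fin 2 → ℂ // eval y f = c}) : Fin 2 → ℂ) ∈ W := by
      rw [← hW1K] at hyK; exact hyK
    have hyR := hKU hyK
    obtain ⟨⟨y, hyf⟩, hyB⟩ := y
    simp only at hyW ⊢
    have hyR : ‖y‖ < R := hyR
    have hV : IsOpen (W ∩ Metric.ball 0 R) := hW.inter Metric.isOpen_ball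
    have hV' := hV.preimage (fmcPt_cont i)
    have := fmc_hurwitz (fun z => eval (fmcPt i z.1 z.2) f)
      ((MvPolynomial.continuous_eval f).comp (fmcPt_cont i)) (fun x => fmcPt_diff i x f) c
      (y i) (y (i + 1)) (by simp only [fmcPt_self]; exact hyf) (hs _) _
      (hV'.mem_nhds (by simp [fmcPt_self, hyW, hyR]))
    filter_upwards [this] with x hx
    obtain ⟨t, ⟨htW, htR⟩, htf⟩ := hx
    refine ⟨⟨⟨fmcPt i x t, htf⟩, ?_⟩, ?_, fmcPt_apply i x t⟩
    · exact Metric.ball_subset_closedBall htR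
    · rw [← hW1K]
      exact htW
  have hcl : IsClopen P := ⟨hPc.isClosed, hPo⟩
  have huniv : P = Set.univ := hcl.eq_univ ⟨_, z0, hzK, rfl⟩
  rw [huniv] at hPc
  exact noncompact_univ ℂ hPc

lemma fmc_slice_finite (f : MvPolynomial (Fin 2) ℂ) (i : Fin 2) (c x : ℂ)
    (hs : ∃ t, eval (fmcPt i x t) f ≠ c) : {t | eval (fmcPt i x t) f = c}.Finite := by
  obtain ⟨t, ht⟩ := hs
  have e : ∀ t, (fun k => Polynomial.eval t ((fun k : Fin 2 => if k = i then Polynomial.C x else Polynomial.X) k))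
      = fmcPt i x t := by
    intro t; ext k; simp only [fmcPt]; split_ifs <;> simp
  have := fmc_finite (f - C c) (fun k => if k = i then Polynomial.C x else Polynomial.X) t
    (by rw [e]; simpa [sub_eq_zero] using ht)
  simp only [e] at this
  simpa [sub_eq_zero] using this

lemma fmc_proj_infinite (f : MvPolynomial (Fin 2) ℂ) (i : Fin 2) (c : ℂ)
    (hs : ∀ x, ∃ t, eval (fmcPt i x t) f ≠ c) (z : {y : Fin 2 → ℂ // eval y f = c}) :
    ((fun y : {y : Fin 2 → ℂ // eval y f = c} => (y : Fin 2 → ℂ) i) '' connectedComponent z).Infinite := by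
  intro hfin
  apply fmc_unbounded f i c hs z
  have h1 : (⋃ x ∈ ((fun y : {y : Fin 2 → ℂ // eval y f = c} => (y : Fin 2 → ℂ) i) ''
      connectedComponent z), (fun t => fmcPt i x t) '' {t | eval (fmcPt i x t) f = c}).Finite :=
    hfin.biUnion fun x _ => (fmc_slice_finite f i c x (hs x)).image _
  obtain ⟨R, hR⟩ := h1.isBounded.exists_norm_le
  refine ⟨R + 1, fun y hy => ?_⟩
  have : ‖(y : Fin 2 → ℂ)‖ ≤ R := by
    apply hR
    refine Set.mem_biUnion ⟨y, hy, rfl⟩ ⟨(y : Fin 2 → ℂ) (i + 1), ?_, fmcPt_self i _⟩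
    simp only [Set.mem_ofPred_eq, fmcPt_self]
    exact y.2
  linarith

lemma fmc_bad_slices (f : MvPolynomial (Fin 2) ℂ) (i : Fin 2)
    (h : AlgebraicIndependent ℂ ![f, X i]) :
    {c : ℂ | ∃ x, ∀ t, eval (fmcPt i x t) f = c}.Finite := by
  have hex : ∃ x t, eval (fmcPt i x t) f ≠ eval (fmcPt i x 0) f := by
    by_contra hcon
    push Not at hcon
    -- `f` is a polynomial in `X i` only
    let q : MvPolynomial (Fin 2) ℂ := aeval (fun k : Fin 2 => if k = i then (X 1) else 0) f
    have hq : X 0 - q ≠ 0 := by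
      intro h0
      have := congrArg (eval ![1 + eval (fmcPt i 0 0) f, 0]) h0
      have e2 : ∀ w : Fin 2 → ℂ, eval w q = eval (fmcPt i (w 1) 0) f := by
        intro w
        have : ((aeval w : MvPolynomial (Fin 2) ℂ →ₐ[ℂ] ℂ).comp
            (aeval (fun k : Fin 2 => if k = i then (X 1 : MvPolynomial (Fin 2) ℂ) else 0))) =
            aeval (fmcPt i (w 1) 0) := by
          ext k; by_cases hk : k = i <;> simp [hk, fmcPt]
        have h2 := DFunLike.congr_fun this f
        simpa [MvPolynomial.aeval_eq_eval, q] using h2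
      rw [map_sub, e2] at this
      simp at this
    apply hq
    apply h
    apply MvPolynomial.funext
    intro w
    have e3 : ∀ w : Fin 2 → ℂ, eval w (aeval ![f, X i] q) = eval (fmcPt i (w i) 0) f := by
      intro w
      have : ((aeval w : MvPolynomial (Fin 2) ℂ →ₐ[ℂ] ℂ).comp ((aeval ![f, X i]).comp
          (aeval (fun k : Fin 2 => if k = i then (X 1 : MvPolynomial (Fin 2) ℂ) else 0)))) =
          aeval (fmcPt i (w i) 0) := by
        ext k; by_cases hk : k = i <;> simp [hk, fmcPt]
      have h2 := DFunLike.congr_fun this f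
      simpa [MvPolynomial.aeval_eq_eval, q] using h2
    rw [map_sub, map_sub, e3, ← hcon _ (w (i + 1)), fmcPt_self]
    simp
  obtain ⟨x0, t, hxt⟩ := hex
  -- one-variable polynomials in `x`
  let v : ℂ → Fin 2 → Polynomial ℂ := fun t k => if k = i then Polynomial.X else Polynomial.C t
  have e : ∀ t x, (fun k => Polynomial.eval x (v t k)) = fmcPt i x t := by
    intro t x; ext k; simp only [fmcPt, v]; split_ifs <;> simp
  have e4 : ∀ t x, (aeval (v t) f).eval x = eval (fmcPt i x t) f := by
    intro t x
    have : ((Polynomial.aeval x : Polynomial ℂ →ₐ[ℂ] ℂ).comp (aeval (v t))) =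
        aeval (fmcPt i x t) := by
      ext k; rw [← e]; simp
    have h2 := DFunLike.congr_fun this f
    simpa [MvPolynomial.aeval_eq_eval] using h2
  let d : Polynomial ℂ := aeval (v t) f - aeval (v 0) f
  have hd : d ≠ 0 := by
    intro h0
    apply hxt
    have := congrArg (Polynomial.eval x0) h0
    simpa [d, e4, sub_eq_zero] using this
  refine ((d.rootSet_finite ℂ).image fun x => eval (fmcPt i x 0) f).subset ?_
  rintro c ⟨x, hx⟩
  refine ⟨x, ?_, hx 0⟩
  rw [Polynomial.mem_rootSet]
  refine ⟨hd, ?_⟩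
  simp [d, e4, hx]

theorem fiber_meets_all_components
    (f g : MvPolynomial (Fin 2) ℂ)
    (hind : ∀ h : MvPolynomial (Fin 2) ℂ, aeval ![f, g] h = 0 → h = 0) :
    ∃ S : Finset ℂ, ∀ c : ℂ, c ∉ S →
      ∃ Sc : Finset ℂ, ∀ ρ : ℂ, ρ ∉ Sc →
        ∀ x : {y : Fin 2 → ℂ // eval y f = c},
          ∃ y ∈ connectedComponent x, eval (y : Fin 2 → ℂ) g = ρ := by
  have hfg : AlgebraicIndependent ℂ ![f, g] := (injective_iff_map_eq_zero _).2 hind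
  have he : ∀ (a b : MvPolynomial (Fin 2) ℂ) (z : Fin 2 → ℂ) (m : MvPolynomial (Fin 2) ℂ),
      eval z (aeval ![a, b] m) = eval ![eval z a, eval z b] m := by
    intro a b z m
    have : ((aeval z : MvPolynomial (Fin 2) ℂ →ₐ[ℂ] ℂ).comp (aeval ![a, b])) =
        aeval ![eval z a, eval z b] := by
      ext k; fin_cases k <;> simp [MvPolynomial.aeval_eq_eval]
    have h2 := DFunLike.congr_fun this m
    simpa [MvPolynomial.aeval_eq_eval] using h2
  have hJ := fmc_J_ne f g hfg
  obtain ⟨i, hi⟩ := fmc_exchange f g hfg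
  obtain ⟨m0, hm0, hd0⟩ := fmc_dvd f g _ hfg hJ
  obtain ⟨m1, hm1, hd1⟩ := fmc_dvd f (X i) _ hi hJ
  obtain ⟨l0, hl0, n0, p0, hp0⟩ := fmc_integral f g (X 0) hfg
  obtain ⟨l1, hl1, n1, p1, hp1⟩ := fmc_integral f g (X 1) hfg
  have hM : m0 * l0 * l1 ≠ 0 := mul_ne_zero (mul_ne_zero hm0 hl0) hl1
  have F1 := fmc_finite1 _ hM
  have F2 := fmc_finite1 _ hm1
  have F3 := fmc_bad_slices f i hi
  refine ⟨F1.toFinset ∪ F2.toFinset ∪ F3.toFinset, fun c hc => ?_⟩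
  simp only [Finset.mem_union, Set.Finite.mem_toFinset, not_or] at hc
  obtain ⟨⟨c1, c2⟩, c3⟩ := hc
  have G1 := fmc_finite2 _ c c1
  have G2 := fmc_finite2 _ c c2
  refine ⟨G1.toFinset, fun ρ hρ x => ?_⟩
  have hs : ∀ x, ∃ t, eval (fmcPt i x t) f ≠ c := by
    simpa using c3
  let T : Set ℂ := {ρ | ∃ y ∈ connectedComponent x, eval (y : Fin 2 → ℂ) g = ρ}
  have hopen : ∀ y ∈ connectedComponent x, eval (y : Fin 2 → ℂ) (fmcJ f g) ≠ 0 →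
      T ∈ 𝓝 (eval (y : Fin 2 → ℂ) g) := by
    intro y hy hyJ
    filter_upwards [fmc_local_open f g c y hyJ] with ρ' hρ'
    rw [← connectedComponent_eq hy] at hρ'
    exact hρ'
  have hS : IsPreconnected ({t : ℂ | eval ![c, t] (m0 * l0 * l1) = 0}ᶜ) :=
    (G1.countable.isConnected_compl_of_one_lt_rank (by simp)).isPreconnected
  have hTS : T ∩ {t : ℂ | eval ![c, t] (m0 * l0 * l1) = 0}ᶜ ⊆ interior T := by
    rintro _ ⟨⟨y, hy, rfl⟩, hyS⟩
    rw [mem_interior_iff_mem_nhds]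
    apply hopen y hy
    intro h0
    obtain ⟨q, hq⟩ := hd0
    have := congrArg (eval (y : Fin 2 → ℂ)) hq
    rw [he, y.2, map_mul, h0, zero_mul] at this
    apply hyS
    simp [this]
  have hcl : closure T ∩ {t : ℂ | eval ![c, t] (m0 * l0 * l1) = 0}ᶜ ⊆ T := by
    rintro ρ ⟨hρT, hρS⟩
    have hρS : eval ![c, ρ] (m0 * l0 * l1) ≠ 0 := hρS
    simp only [map_mul, mul_ne_zero_iff] at hρS
    obtain ⟨M0, hM0⟩ := fmc_proper f g (X 0) l0 n0 p0 hp0 c ρ hρS.1.2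
    obtain ⟨M1, hM1⟩ := fmc_proper f g (X 1) l1 n1 p1 hp1 c ρ hρS.2
    have hclosed : IsClosed {y : Fin 2 → ℂ | eval y f = c} :=
      isClosed_eq (MvPolynomial.continuous_eval f) continuous_const
    have hcomp : IsCompact (connectedComponent x ∩
        Subtype.val ⁻¹' Metric.closedBall (0 : Fin 2 → ℂ) (max 0 (max M0 M1))) :=
      (hclosed.isClosedEmbedding_subtypeVal.isCompact_preimage
        (isCompact_closedBall _ _)).inter_left isClosed_connectedComponent
    have himg := (hcomp.image (f := fun y : {y : Fin 2 → ℂ // eval y f = c} => eval (y : Fin 2 → ℂ) g)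
      ((MvPolynomial.continuous_eval g).comp continuous_subtype_val)).isClosed
    have hmem : ρ ∈ closure ((fun y : {y : Fin 2 → ℂ // eval y f = c} => eval (y : Fin 2 → ℂ) g) ''
        (connectedComponent x ∩
        Subtype.val ⁻¹' Metric.closedBall (0 : Fin 2 → ℂ) (max 0 (max M0 M1)))) := by
      rw [mem_closure_iff_frequently] at hρT ⊢
      refine (hρT.and_eventually (hM0.and hM1)).mono ?_
      rintro _ ⟨⟨y, hy, rfl⟩, h0, h1⟩
      refine ⟨y, ⟨hy, ?_⟩, rfl⟩
      have h0 := h0 y y.2 rfl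
      have h1 := h1 y y.2 rfl
      simp only [eval_X] at h0 h1
      rw [Set.mem_preimage, mem_closedBall_zero_iff, pi_norm_le_iff_of_nonneg (le_max_left _ _)]
      intro k
      fin_cases k
      · exact h0.trans ((le_max_left _ _).trans (le_max_right _ _))
      · exact h1.trans ((le_max_right _ _).trans (le_max_right _ _))
    rw [himg.closure_eq] at hmem
    obtain ⟨y, ⟨hy, _⟩, hyρ⟩ := hmem
    exact ⟨y, hy, hyρ⟩
  have hne : ({t : ℂ | eval ![c, t] (m0 * l0 * l1) = 0}ᶜ ∩ interior T).Nonempty := by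
    obtain ⟨_, ⟨y, hy, rfl⟩, hy1⟩ := (fmc_proj_infinite f i c hs x).exists_notMem_finite G2
    have hyJ : eval (y : Fin 2 → ℂ) (fmcJ f g) ≠ 0 := by
      intro h0
      obtain ⟨q, hq⟩ := hd1
      have := congrArg (eval (y : Fin 2 → ℂ)) hq
      rw [he, y.2, map_mul, h0, zero_mul, eval_X] at this
      exact hy1 this
    have hTn := hopen y hy hyJ
    have hint : (interior T).Infinite :=
      infinite_of_mem_nhds _ (interior_mem_nhds.2 hTn)
    obtain ⟨t, ht, ht'⟩ := hint.exists_notMem_finite G1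
    exact ⟨t, ht', ht⟩
  have hfinal := hS.subset_of_closure_inter_subset isOpen_interior hne (by
    rintro t ⟨ht, htS⟩
    exact hTS ⟨hcl ⟨closure_mono interior_subset ht, htS⟩, htS⟩)
  have : ρ ∈ interior T := hfinal (by simpa using hρ)
  have hρT : ρ ∈ T := interior_subset this
  exact hρT
end

section
/- Let f and g be polynomials in two complex variables that are algebraically independent over ℂ. Then the image of the map ℂ² → ℂ², x ↦ (f(x), g(x)), is dense in ℂ² for the Euclidean topology. -/
open MvPolynomial

theorem aux_generic {R S : Type*} [CommRing R] [IsDomain R] [CommRing S] [IsDomain S]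
    (φ : R →+* S) (hφ : φ.FinitePresentation) (hinj : Function.Injective φ) :
    ∃ r : R, r ≠ 0 ∧ ∀ p : PrimeSpectrum R, r ∉ p.asIdeal →
      p ∈ Set.range (PrimeSpectrum.comap φ) := by
  obtain ⟨T, hT⟩ := PrimeSpectrum.exists_constructibleSetData_iff.mpr
    (PrimeSpectrum.isConstructible_range_comap hφ)
  have hbot : (⟨⊥, Ideal.isPrime_bot⟩ : PrimeSpectrum R) ∈ T.toSet := by
    rw [hT]
    refine ⟨⟨⊥, Ideal.isPrime_bot⟩, ?_⟩
    ext x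
    simp [map_eq_zero_iff φ hinj]
  simp only [PrimeSpectrum.ConstructibleSetData.toSet, Set.mem_iUnion] at hbot
  obtain ⟨C, hC, h1⟩ := hbot
  simp only [PrimeSpectrum.BasicConstructibleSetData.toSet, Set.mem_diff,
    PrimeSpectrum.mem_zeroLocus] at h1
  refine ⟨C.f, fun h => h1.2 (by simp [h]), fun p hp => ?_⟩
  rw [← hT]
  simp only [PrimeSpectrum.ConstructibleSetData.toSet, Set.mem_iUnion]
  refine ⟨C, hC, ?_⟩
  simp only [PrimeSpectrum.BasicConstructibleSetData.toSet, Set.mem_diff,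
    PrimeSpectrum.mem_zeroLocus]
  refine ⟨fun x hx => ?_, by simpa using hp⟩
  have : x = 0 := by simpa using h1.1 hx
  simp [this]

/-- If `f` and `g` are algebraically independent over `ℂ`, the image of
`(f,g) : ℂ² → ℂ²` is dense. -/
theorem image_dense_of_algebraically_independent
    (f g : MvPolynomial (Fin 2) ℂ)
    (hind : ∀ h : MvPolynomial (Fin 2) ℂ, aeval ![f, g] h = 0 → h = 0) :
    Dense (Set.range (fun x : Fin 2 → ℂ => (eval x f, eval x g))) := by
  let φ : MvPolynomial (Fin 2) ℂ →ₐ[ℂ] MvPolynomial (Fin 2) ℂ := aeval ![f, g]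
  have hinj : Function.Injective φ := (injective_iff_map_eq_zero φ).mpr hind
  have hft : φ.toRingHom.FiniteType := by
    apply RingHom.FiniteType.of_comp_finiteType (f := C)
    rw [show φ.toRingHom.comp C = C from φ.comp_algebraMap]
    exact RingHom.finiteType_algebraMap.mpr
      (inferInstance : Algebra.FiniteType ℂ (MvPolynomial (Fin 2) ℂ))
  obtain ⟨r, hr0, hr⟩ := aux_generic φ.toRingHom
    (RingHom.FinitePresentation.of_finiteType.mp hft) hinj
  -- points off the zero set of `r` are in the image
  have key : ∀ a : Fin 2 → ℂ, eval a r ≠ 0 →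
      ∃ x : Fin 2 → ℂ, eval x f = a 0 ∧ eval x g = a 1 := by
    intro a ha
    have hm : (vanishingIdeal ℂ {a}).IsMaximal :=
      isMaximal_iff_eq_vanishingIdeal_singleton.mpr ⟨a, rfl⟩
    obtain ⟨q, hq⟩ := hr ⟨vanishingIdeal ℂ {a}, hm.isPrime⟩ (by
      simpa [mem_vanishingIdeal_singleton_iff, aeval_eq_eval] using ha)
    obtain ⟨n, hn, hqn⟩ := q.asIdeal.exists_le_maximal q.2.ne_top
    obtain ⟨x, rfl⟩ := isMaximal_iff_eq_vanishingIdeal_singleton.mp hn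
    have hin : ∀ p : MvPolynomial (Fin 2) ℂ, eval a p = 0 → eval x (φ p) = 0 := by
      intro p hp
      have h1 : p ∈ (PrimeSpectrum.comap φ.toRingHom q).asIdeal := by
        rw [hq]
        simpa [mem_vanishingIdeal_singleton_iff, aeval_eq_eval] using hp
      have h2 : φ p ∈ vanishingIdeal ℂ {x} := hqn h1
      simpa [mem_vanishingIdeal_singleton_iff, aeval_eq_eval] using h2
    refine ⟨x, ?_, ?_⟩
    · have := hin (X 0 - C (a 0)) (by simp)
      simpa [φ, sub_eq_zero, MvPolynomial.algebraMap_eq] using this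
    · have := hin (X 1 - C (a 1)) (by simp)
      simpa [φ, sub_eq_zero, MvPolynomial.algebraMap_eq] using this
  rw [Metric.dense_iff]
  rintro ⟨u, v⟩ ε hε
  by_contra hne
  apply hr0
  refine MvPolynomial.funext_set (fun i : Fin 2 => Metric.ball (![u, v] i) ε) (fun i => ?_) ?_
  · exact infinite_of_mem_nhds _ (Metric.ball_mem_nhds _ hε)
  · intro a ha
    rw [map_zero]
    by_contra hra
    obtain ⟨x, hx0, hx1⟩ := key a hra
    apply hne
    refine ⟨(a 0, a 1), ?_, x, by simp [hx0, hx1]⟩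
    have h0 := ha 0 trivial
    have h1 := ha 1 trivial
    rw [← ball_prod_same]
    exact ⟨by simpa using h0, by simpa using h1⟩
end

section
/- Let f and g be polynomials in two complex variables that are algebraically independent over ℂ, and let J = (∂f/∂x)(∂g/∂y) − (∂f/∂y)(∂g/∂x) be their Jacobian determinant, a polynomial in two variables. Then there exists a nonzero polynomial h ∈ ℂ[u,v] such that for every x ∈ ℂ² with J(x) = 0 one has h(f(x), g(x)) = 0; that is, the set of critical values of the map (f,g) : ℂ² → ℂ² is contained in an algebraic curve. -/
open MvPolynomial

/-- In characteristic zero, a derivation of a domain killing every element of a subalgebra `A` kills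
every element that is algebraic over `A`. -/
theorem derivation_eq_zero_of_isAlgebraic {B : Type*} [CommRing B] [IsDomain B] [Algebra ℂ B]
    (A : Subalgebra ℂ B) (D : Derivation ℂ B B) (hD : ∀ a ∈ A, D a = 0)
    (z : B) (hz : IsAlgebraic A z) : D z = 0 := by
  let D' : Derivation A B B := Derivation.mk'
    { toFun := D
      map_add' := fun a b => map_add D a b
      map_smul' := fun a b => by
        have h := hD a a.2
        simp [Algebra.smul_def, h] }
    (fun a b => D.leibniz a b)
  have hDD : D' z = D z := rfl
  have key : ∀ n : ℕ, ∀ P : Polynomial A, P.natDegree = n → P ≠ 0 → Polynomial.aeval z P = 0 →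
      D z = 0 := by
    intro n
    induction n using Nat.strong_induction_on with
    | _ n ih =>
      intro P hn hP h0
      have hdeg : P.natDegree ≠ 0 := by
        intro h
        rw [Polynomial.eq_C_of_natDegree_eq_zero h] at h0 hP
        simp at h0 hP
        exact hP h0
      have hlt := Polynomial.natDegree_derivative_lt hdeg
      have h1 := D'.map_aeval P z
      rw [h0, map_zero, hDD, smul_eq_mul] at h1
      rcases mul_eq_zero.1 h1.symm with h | h
      · refine ih _ (hn ▸ hlt) P.derivative rfl ?_ h
        intro h'
        have : CharZero A := charZero_of_injective_algebraMap (algebraMap ℂ A).injective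
        exact hdeg (Polynomial.derivative_eq_zero.1 h')
      · exact h
  obtain ⟨P, hP, h0⟩ := hz
  exact key _ P rfl hP h0

/-- If `f` and `g` are algebraically independent over `ℂ`, the set of critical values of
`(f,g) : ℂ² → ℂ²` (images of zeros of the Jacobian determinant) is contained in an
algebraic curve `{h = 0}` with `h ≠ 0`. -/
theorem critical_values_in_curve
    (f g : MvPolynomial (Fin 2) ℂ)
    (hind : ∀ h : MvPolynomial (Fin 2) ℂ, aeval ![f, g] h = 0 → h = 0)
    (J : MvPolynomial (Fin 2) ℂ)
    (hJ : J = pderiv 0 f * pderiv 1 g - pderiv 1 f * pderiv 0 g) :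
    ∃ h : MvPolynomial (Fin 2) ℂ, h ≠ 0 ∧
      ∀ x : Fin 2 → ℂ, eval x J = 0 → eval ![eval x f, eval x g] h = 0 := by
  have hai : AlgebraicIndependent ℂ ![f, g] :=
    (injective_iff_map_eq_zero (aeval ![f, g] : MvPolynomial (Fin 2) ℂ →ₐ[ℂ] _)).2 hind
  have htb : IsTranscendenceBasis ℂ ![f, g] :=
    hai.isTranscendenceBasis_of_lift_trdeg_le_of_finite (by simp [MvPolynomial.trdeg_of_isDomain])
  have halg : Algebra.IsAlgebraic (Algebra.adjoin ℂ (Set.range ![f, g])) (MvPolynomial (Fin 2) ℂ) :=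
    htb.isAlgebraic
  have kill : ∀ D : Derivation ℂ (MvPolynomial (Fin 2) ℂ) (MvPolynomial (Fin 2) ℂ),
      D f = 0 → D g = 0 → ∀ z, D z = 0 := by
    intro D hf hg z
    refine derivation_eq_zero_of_isAlgebraic _ D (fun a ha => ?_) z (halg.1 z)
    refine Derivation.eqOn_adjoin (D1 := D) (D2 := 0) ?_ ha
    rintro _ ⟨i, rfl⟩
    fin_cases i <;> simp [hf, hg]
  have hJ0 : J ≠ 0 := by
    intro h0
    rw [h0] at hJ
    have h1 := kill (pderiv 1 f • pderiv 0 - pderiv 0 f • pderiv 1)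
      (by simp; ring) (by simp; linear_combination hJ) (X 1)
    have h2 := kill (pderiv 1 g • pderiv 0 - pderiv 0 g • pderiv 1)
      (by simp; linear_combination -hJ) (by simp; ring) (X 1)
    simp at h1 h2
    have h3 := kill (pderiv 0) h1 h2 (X 0)
    simp at h3
  obtain ⟨r, hr, q, hq⟩ := (halg.1 J).exists_nonzero_dvd (mem_nonZeroDivisors_of_ne_zero hJ0)
  obtain ⟨r, hrm⟩ := r
  have hrm' := hrm
  rw [Algebra.adjoin_range_eq_range_aeval] at hrm'
  obtain ⟨h, rfl⟩ := hrm'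
  refine ⟨h, ?_, fun x hx => ?_⟩
  · rintro rfl
    exact hr (by ext1; simp)
  · have h1 : aeval ![f, g] h = J * q := hq
    have h2 := congrArg (eval x) h1
    rw [map_mul, hx, zero_mul] at h2
    rw [← h2]
    have h3 : ((aeval x : MvPolynomial (Fin 2) ℂ →ₐ[ℂ] ℂ).comp (aeval ![f, g])) =
        aeval ![eval x f, eval x g] := by
      ext i
      fin_cases i <;> simp [aeval_eq_eval]
    have h4 := DFunLike.congr_fun h3 h
    simpa [aeval_eq_eval] using h4.symm
end
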